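/- arXiv:2401.06325 — 4 statements merged into one kernel-verified Lean document; each statement's English description precedes it below -/
import Mathlib

section
/- Let d ≥ 1 and L > 0. Let f : ℝ^d → ℝ be continuously differentiable with L-Lipschitz gradient, such that e^{-f} is Lebesgue integrable, and let p = e^{-f} / ∫_{ℝ^d} e^{-f(y)} dy be the associated probability density. Then ∫_{ℝ^d} p(x) ‖∇f(x)‖² dx ≤ L·d. -/
open MeasureTheory Real

/-- If `g` is the derivative of `f` along `e` and is `L`-Lipschitz along `e`, the increment of `f` is
`h * g x` up to `L * h ^ 2`. -/
theorem abs_sub_sub_mul_le_of_hasLineDerivAt {E : Type*} [NormedAddCommGroup E] [NormedSpace ℝ E]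
    {f g : E → ℝ} {e : E} {L : ℝ} (hL : 0 ≤ L) (hf : ∀ x, HasLineDerivAt ℝ f (g x) x e)
    (hg : ∀ x (t : ℝ), |g (x + t • e) - g x| ≤ L * |t|) (x : E) {h : ℝ} (hh : 0 < h) :
    |f (x + h • e) - f x - h * g x| ≤ L * h ^ 2 := by
  have hd : ∀ s : ℝ, HasDerivAt (fun t : ℝ => f (x + t • e)) (g (x + s • e)) s := by
    intro s
    have h1 : HasDerivAt (fun t : ℝ => f (x + s • e + t • e)) (g (x + s • e)) (s - s) := by
      rw [sub_self]
      exact hf (x + s • e)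
    refine (h1.comp_sub_const s s).congr_of_eventuallyEq (Filter.Eventually.of_forall fun t => ?_)
    simp only [add_assoc, ← add_smul, add_sub_cancel]
  obtain ⟨s, ⟨hs0, hsh⟩, hs⟩ := exists_hasDerivAt_eq_slope (fun t : ℝ => f (x + t • e)) _ hh
    (fun t _ => (hd t).continuousAt.continuousWithinAt) (fun t _ => hd t)
  have hinc : f (x + h • e) - f x = h * g (x + s • e) := by
    rw [hs, sub_zero, zero_smul, add_zero, mul_div_cancel₀ _ hh.ne']
  rw [hinc, ← mul_sub, abs_mul, abs_of_pos hh]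
  have h2 := hg x s
  rw [abs_of_pos hs0] at h2
  calc h * |g (x + s • e) - g x| ≤ h * (L * h) := by gcongr; exact h2.trans (by gcongr)
    _ = L * h ^ 2 := by ring

theorem exp_neg_mul_le_exp_neg_mul {a b g h c : ℝ} (hab : |b - a - h * g| ≤ c) :
    exp (-b) * (g + h * max g 0 ^ 2 - c * max g 0) ≤
      exp (-a) * (g - h * max (-g) 0 ^ 2 + c * max (-g) 0) := by
  obtain ⟨h1, h2⟩ := abs_le.1 hab
  rcases le_total 0 g with hg | hg
  · rw [max_eq_left hg, max_eq_right (neg_nonpos.2 hg)]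
    have h3 : exp (-b) * (1 + h * g - c) ≤ exp (-a) := by
      calc exp (-b) * (1 + h * g - c) ≤ exp (-b) * exp (b - a) := by
            gcongr
            linarith [add_one_le_exp (b - a)]
        _ = exp (-a) := by rw [← exp_add]; ring_nf
    nlinarith [mul_le_mul_of_nonneg_right h3 hg]
  · rw [max_eq_right hg, max_eq_left (neg_nonneg.2 hg)]
    have h3 : exp (-a) * (1 - h * g - c) ≤ exp (-b) := by
      calc exp (-a) * (1 - h * g - c) ≤ exp (-a) * exp (a - b) := by
            gcongr
            linarith [add_one_le_exp (a - b)]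
        _ = exp (-b) := by rw [← exp_add]; ring_nf
    nlinarith [mul_le_mul_of_nonneg_right h3 (neg_nonneg.2 hg)]

theorem mul_sq_sub_le_of_abs_sub_le {g k L h : ℝ} (hL : 0 ≤ L) (hh : 0 < h) (hh1 : h ≤ 1)
    (hgk : |k - g| ≤ L * h) :
    h * (g ^ 2 - L - h * ((4 * L + L ^ 2) * (1 + g ^ 2))) ≤
      (k + h * max k 0 ^ 2 - L * h ^ 2 * max k 0) -
        (g - h * max (-g) 0 ^ 2 + L * h ^ 2 * max (-g) 0) := by
  obtain ⟨h1, -⟩ := abs_le.1 hgk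
  have hq : |max k 0 - max g 0| ≤ L * h := (abs_max_sub_max_le_abs k g 0).trans hgk
  obtain ⟨h3, h4⟩ := abs_le.1 hq
  have hsq : max g 0 ^ 2 + max (-g) 0 ^ 2 = g ^ 2 := by
    rcases le_total 0 g with hg | hg <;> simp [hg]
  have habs : max g 0 + max (-g) 0 ≤ 1 + g ^ 2 := by
    rcases le_total 0 g with hg | hg <;> simp [hg] <;>
      nlinarith [sq_nonneg (g - 1), sq_nonneg (g + 1)]
  have hp : 0 ≤ max g 0 := le_max_right _ _
  have hm : 0 ≤ max (-g) 0 := le_max_right _ _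
  have hk : 0 ≤ max k 0 := le_max_right _ _
  rw [← hsq] at habs ⊢
  generalize max g 0 = u at *
  generalize max (-g) 0 = v at *
  generalize max k 0 = q at *
  have hq2 : u ^ 2 - 2 * (L * h) * u ≤ q ^ 2 := by nlinarith [sq_nonneg (q - u)]
  have hLh : 0 ≤ L * h ^ 2 := by positivity
  have e1 := mul_le_mul_of_nonneg_left hq2 hh.le
  have e2 : L * h ^ 2 * q ≤ L * h ^ 2 * (u + L) :=
    mul_le_mul_of_nonneg_left (by nlinarith) hLh
  have e3 := mul_le_mul_of_nonneg_left habs hLh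
  have e4 : 0 ≤ L * h ^ 2 * v := by positivity
  have e5 : 0 ≤ L * h ^ 2 * u := by positivity
  have e6 : 0 ≤ L ^ 2 * h ^ 2 * (u ^ 2 + v ^ 2) := by positivity
  have e7 : 0 ≤ L * h ^ 2 * (u ^ 2 + v ^ 2) := by positivity
  nlinarith

theorem abs_add_mul_sq_sub_mul_le {h c L : ℝ} (k : ℝ) (hh : 0 ≤ h) (hh1 : h ≤ 1) (hc : 0 ≤ c)
    (hcL : c ≤ L) :
    |k + h * max k 0 ^ 2 - c * max k 0| ≤ (2 + L) * (1 + k ^ 2) := by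
  rcases le_total 0 k with hk | hk
  · rw [max_eq_left hk]
    have h1 : h * k ^ 2 ≤ 1 * k ^ 2 := by gcongr
    have h2 : c * k ≤ L * k := by gcongr
    have h3 : k ≤ 1 + k ^ 2 := by nlinarith [sq_nonneg (k - 1)]
    have h4 : L * k ≤ L * (1 + k ^ 2) := mul_le_mul_of_nonneg_left h3 (hc.trans hcL)
    have h5 : 0 ≤ c * k := by positivity
    have h6 : 0 ≤ h * k ^ 2 := by positivity
    have h7 : 0 ≤ L * (1 + k ^ 2) := mul_nonneg (hc.trans hcL) (by positivity)
    rw [abs_le]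
    constructor <;> linarith
  · rw [max_eq_right hk]
    have h7 : 0 ≤ L * (1 + k ^ 2) := mul_nonneg (hc.trans hcL) (by positivity)
    rw [abs_le]
    constructor <;> nlinarith [sq_nonneg (k + 1)]

theorem integral_exp_neg_mul_sq_le_of_hasLineDerivAt {E : Type*} [NormedAddCommGroup E]
    [NormedSpace ℝ E] [FiniteDimensional ℝ E] [MeasurableSpace E] [BorelSpace E] {μ : Measure E}
    [μ.IsAddRightInvariant] {f g : E → ℝ} {e : E} {L : ℝ} (hL : 0 ≤ L) (hfc : Continuous f)
    (hgc : Continuous g) (hf : ∀ x, HasLineDerivAt ℝ f (g x) x e)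
    (hg : ∀ x (t : ℝ), |g (x + t • e) - g x| ≤ L * |t|)
    (hint : Integrable (fun x => exp (-f x)) μ)
    (hint2 : Integrable (fun x => exp (-f x) * g x ^ 2) μ) :
    ∫ x, exp (-f x) * g x ^ 2 ∂μ ≤ L * ∫ x, exp (-f x) ∂μ := by
  have hdom : Integrable (fun x => exp (-f x) * (1 + g x ^ 2)) μ := by
    simp only [mul_add, mul_one]
    exact hint.add hint2
  have hbdd : ∀ (B : E → ℝ) (C : ℝ), Continuous B → (∀ x, |B x| ≤ C * (1 + g x ^ 2)) →
      Integrable (fun x => exp (-f x) * B x) μ := by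
    intro B C hB hBC
    refine (hdom.const_mul C).mono' (by fun_prop) (.of_forall fun x => ?_)
    rw [norm_mul, norm_of_nonneg (exp_pos _).le, norm_eq_abs, mul_left_comm]
    exact mul_le_mul_of_nonneg_left (hBC x) (exp_pos _).le
  set K := 4 * L + L ^ 2
  have key : ∀ h : ℝ, 0 < h → h ≤ 1 → ∫ x, exp (-f x) * g x ^ 2 ∂μ ≤
      L * ∫ x, exp (-f x) ∂μ + h * (K * ∫ x, exp (-f x) * (1 + g x ^ 2) ∂μ) := by
    intro h hh hh1
    let A : E → ℝ := fun x => g x + h * max (g x) 0 ^ 2 - L * h ^ 2 * max (g x) 0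
    let B : E → ℝ := fun x => g x - h * max (-g x) 0 ^ 2 + L * h ^ 2 * max (-g x) 0
    have hshift : ∀ x, |g (x - h • e) - g x| ≤ L * h := by
      intro x
      simpa [abs_of_pos hh, sub_eq_add_neg] using hg x (-h)
    have hc : 0 ≤ L * h ^ 2 := by positivity
    have hcL : L * h ^ 2 ≤ L := mul_le_of_le_one_right hL (pow_le_one₀ hh.le hh1)
    have hA : Integrable (fun x => exp (-f x) * A (x - h • e)) μ := by
      refine hbdd _ ((2 + L) * (2 * (1 + L) ^ 2)) (by fun_prop) fun x => ?_
      refine (abs_add_mul_sq_sub_mul_le (g (x - h • e)) hh.le hh1 hc hcL).trans ?_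
      rw [mul_assoc]
      gcongr
      obtain ⟨h1, h2⟩ := abs_le.1 ((hshift x).trans (mul_le_of_le_one_right hL hh1))
      nlinarith [sq_nonneg (g (x - h • e) - 2 * g x), mul_nonneg hL (sq_nonneg (g x)),
        mul_nonneg (sq_nonneg L) (sq_nonneg (g x)),
        mul_nonneg (sub_nonneg.2 h1) (sub_nonneg.2 h2)]
    have hB : Integrable (fun x => exp (-f x) * B x) μ := by
      refine hbdd _ (2 + L) (by fun_prop) fun x => ?_
      have := abs_add_mul_sq_sub_mul_le (-g x) hh.le hh1 hc hcL
      rw [neg_sq, ← abs_neg] at this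
      convert this using 2
      ring
    have hA' : Integrable (fun x => exp (-f (x + h • e)) * A x) μ := by
      simpa using hA.comp_add_right (h • e)
    have htrans : ∫ x, exp (-f (x + h • e)) * A x ∂μ = ∫ x, exp (-f x) * A (x - h • e) ∂μ := by
      simpa using integral_add_right_eq_self (μ := μ) (fun x => exp (-f x) * A (x - h • e)) (h • e)
    have h1 : ∫ x, exp (-f x) * A (x - h • e) ∂μ ≤ ∫ x, exp (-f x) * B x ∂μ := by
      rw [← htrans]
      exact integral_mono hA' hB fun x =>
        exp_neg_mul_le_exp_neg_mul (abs_sub_sub_mul_le_of_hasLineDerivAt hL hf hg x hh)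
    have h2 : ∫ x, h * (exp (-f x) * g x ^ 2 - L * exp (-f x)
          - h * (K * (exp (-f x) * (1 + g x ^ 2)))) ∂μ ≤
        ∫ x, (exp (-f x) * A (x - h • e) - exp (-f x) * B x) ∂μ := by
      refine integral_mono (((hint2.sub (hint.const_mul L)).sub
        ((hdom.const_mul K).const_mul h)).const_mul h) (hA.sub hB) fun x => ?_
      have := mul_le_mul_of_nonneg_left (mul_sq_sub_le_of_abs_sub_le hL hh hh1 (hshift x))
        (exp_pos (-f x)).le
      dsimp only [A, B]
      linarith
    have hint3 : Integrable (fun x => exp (-f x) * g x ^ 2 - L * exp (-f x)) μ :=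
      hint2.sub (hint.const_mul L)
    rw [integral_const_mul, integral_sub hA hB,
      integral_sub hint3 ((hdom.const_mul K).const_mul h),
      integral_sub hint2 (hint.const_mul L), integral_const_mul, integral_const_mul,
      integral_const_mul] at h2
    have h3 := nonpos_of_mul_nonpos_right (h2.trans (sub_nonpos.2 h1)) hh
    linarith
  have hlim : Filter.Tendsto (fun h : ℝ => L * ∫ x, exp (-f x) ∂μ +
      h * (K * ∫ x, exp (-f x) * (1 + g x ^ 2) ∂μ)) (nhdsWithin 0 (Set.Ioi 0))
      (nhds (L * ∫ x, exp (-f x) ∂μ)) := by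
    refine Filter.Tendsto.mono_left ?_ nhdsWithin_le_nhds
    refine Continuous.tendsto' (by fun_prop) _ _ (by simp)
  refine ge_of_tendsto hlim ?_
  filter_upwards [Ioc_mem_nhdsGT (zero_lt_one' ℝ)] with h hh
  exact key h hh.1 hh.2

/-- If `f : ℝ^d → ℝ` is continuously differentiable with `L`-Lipschitz
gradient, `e^{-f}` is integrable, and `p = e^{-f} / ∫ e^{-f}` is the associated probability
density, then `∫ p(x) ‖∇f(x)‖² dx ≤ L·d`. -/
theorem stmt_0 {d : ℕ} (hd : 1 ≤ d) (L : ℝ) (hL : 0 < L)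
    (f : EuclideanSpace ℝ (Fin d) → ℝ)
    (hf : ContDiff ℝ 1 f)
    (hlip : ∀ x y, ‖gradient f x - gradient f y‖ ≤ L * ‖x - y‖)
    (hint : Integrable (fun x => Real.exp (-f x)))
    (p : EuclideanSpace ℝ (Fin d) → ℝ)
    (hp : p = fun x => Real.exp (-f x) / ∫ y, Real.exp (-f y)) :
    ∫ x, p x * ‖gradient f x‖ ^ 2 ≤ L * d := by
  by_cases hsq : Integrable fun x => p x * ‖gradient f x‖ ^ 2
  swap
  · rw [integral_undef hsq]
    positivity
  have hZ : 0 < ∫ y, exp (-f y) := integral_exp_pos hint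
  have hsq' : Integrable fun x => exp (-f x) * ‖gradient f x‖ ^ 2 := by
    refine (hsq.const_mul (∫ y, exp (-f y))).congr (.of_forall fun x => ?_)
    simp only [hp]
    field_simp
  have hfc : Continuous f := hf.continuous
  have hgc : Continuous (gradient f) :=
    (LipschitzWith.of_dist_le_mul (K := ⟨L, hL.le⟩) fun x y => by
      rw [dist_eq_norm, dist_eq_norm]
      exact hlip x y).continuous
  let b := EuclideanSpace.basisFun (Fin d) ℝ
  have hle : ∀ i x, inner ℝ (gradient f x) (b i) ^ 2 ≤ ‖gradient f x‖ ^ 2 := by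
    intro i x
    have := abs_real_inner_le_norm (gradient f x) (b i)
    rw [b.norm_eq_one, mul_one] at this
    exact sq_le_sq.2 (by rwa [abs_norm])
  have hi : ∀ i, Integrable fun x => exp (-f x) * inner ℝ (gradient f x) (b i) ^ 2 := by
    intro i
    refine hsq'.mono' (by fun_prop) (.of_forall fun x => ?_)
    rw [norm_of_nonneg (by positivity)]
    exact mul_le_mul_of_nonneg_left (hle i x) (exp_pos _).le
  have hcoord : ∀ i, ∫ x, exp (-f x) * inner ℝ (gradient f x) (b i) ^ 2 ≤
      L * ∫ x, exp (-f x) := by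
    intro i
    refine integral_exp_neg_mul_sq_le_of_hasLineDerivAt (e := b i) hL.le hfc (by fun_prop)
      (fun x => ?_) (fun x t => ?_) hint (hi i)
    · have := ((hf.differentiable one_ne_zero) x).hasGradientAt.hasFDerivAt.hasLineDerivAt (b i)
      simpa using this
    · rw [← inner_sub_left]
      refine (abs_real_inner_le_norm _ _).trans ?_
      have := hlip (x + t • b i) x
      rw [add_sub_cancel_left, norm_smul, b.norm_eq_one, mul_one, norm_eq_abs] at this
      rwa [b.norm_eq_one, mul_one]
  have hsum : ∫ x, exp (-f x) * ‖gradient f x‖ ^ 2 ≤ d * (L * ∫ x, exp (-f x)) := by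
    calc ∫ x, exp (-f x) * ‖gradient f x‖ ^ 2
        = ∫ x, ∑ i, exp (-f x) * inner ℝ (gradient f x) (b i) ^ 2 := by
          simp only [← Finset.mul_sum, b.sum_sq_inner_left]
      _ = ∑ i, ∫ x, exp (-f x) * inner ℝ (gradient f x) (b i) ^ 2 :=
          integral_finsetSum _ fun i _ => hi i
      _ ≤ ∑ _i : Fin d, L * ∫ x, exp (-f x) := Finset.sum_le_sum fun i _ => hcoord i
      _ = d * (L * ∫ x, exp (-f x)) := by simp
  simp only [hp, div_mul_eq_mul_div, integral_div]
  rw [div_le_iff₀ hZ]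
  linarith
end

section
/- Let d ≥ 1 and L > 0. Let f : ℝ^d → ℝ be continuously differentiable with L-Lipschitz gradient, e^{-f} integrable, and let p = e^{-f} / ∫ e^{-f} be the associated probability density. Assume the second moment M := ∫_{ℝ^d} p(x) ‖x‖² dx is finite. Then KL(p ‖ γ_d) ≤ L·d + M, where γ_d(x) = (2π)^{-d/2} exp(−‖x‖²/2) is the standard Gaussian density on ℝ^d. -/
open MeasureTheory Real

/-- A function with `L`-Lipschitz gradient has symmetric second differences at most `L * ‖u‖ ^ 2`. -/
theorem add_le_of_gradient_lipschitz {E : Type*} [NormedAddCommGroup E] [InnerProductSpace ℝ E]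
    [CompleteSpace E] {f : E → ℝ} {L : ℝ} (hf : Differentiable ℝ f)
    (hlip : ∀ x y, ‖gradient f x - gradient f y‖ ≤ L * ‖x - y‖) (x u : E) :
    f (x + u) + f (x - u) ≤ 2 * f x + L * ‖u‖ ^ 2 := by
  have hline (v : E) (t : ℝ) :
      HasDerivAt (fun t : ℝ => f (x + t • v)) (inner ℝ (gradient f (x + t • v)) v) t := by
    have h1 : HasDerivAt (fun t : ℝ => x + t • v) v t := by
      simpa using ((hasDerivAt_id t).smul_const v).const_add x
    exact (hf (x + t • v)).hasGradientAt.hasFDerivAt.comp_hasDerivAt t h1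
  have hderiv (t : ℝ) :
      HasDerivAt (fun t : ℝ => f (x + t • u) + f (x + t • (-u)) - L * ‖u‖ ^ 2 * t ^ 2)
        (inner ℝ (gradient f (x + t • u)) u + inner ℝ (gradient f (x + t • (-u))) (-u)
          - L * ‖u‖ ^ 2 * (2 * t)) t := by
    refine (((hline u t).add (hline (-u) t)).sub
      ((hasDerivAt_pow 2 t).const_mul (L * ‖u‖ ^ 2))).congr_deriv ?_
    norm_num
  have hanti : AntitoneOn
      (fun t : ℝ => f (x + t • u) + f (x + t • (-u)) - L * ‖u‖ ^ 2 * t ^ 2) (Set.Icc 0 1) := by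
    refine antitoneOn_of_deriv_nonpos (convex_Icc 0 1)
      (fun t _ => (hderiv t).continuousAt.continuousWithinAt)
      (fun t _ => (hderiv t).differentiableAt.differentiableWithinAt) fun t ht => ?_
    rw [interior_Icc] at ht
    rw [(hderiv t).deriv, inner_neg_right, ← sub_eq_add_neg, ← inner_sub_left, sub_nonpos]
    have h4 : x + t • u - (x + t • (-u)) = (2 * t) • u := by module
    have h5 := hlip (x + t • u) (x + t • (-u))
    rw [h4, norm_smul, Real.norm_of_nonneg (by linarith [ht.1])] at h5
    calc _ ≤ ‖gradient f (x + t • u) - gradient f (x + t • (-u))‖ * ‖u‖ := real_inner_le_norm _ _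
      _ ≤ L * (2 * t * ‖u‖) * ‖u‖ := by gcongr
      _ = _ := by ring
  have h6 := hanti (Set.left_mem_Icc.2 zero_le_one) (Set.right_mem_Icc.2 zero_le_one) zero_le_one
  simp only [one_smul, zero_smul, add_zero, ← sub_eq_add_neg] at h6
  linarith

/-- A density proportional to `exp (-f)`, with `∇f` being `L`-Lipschitz, is bounded above by
the maximum of the Gaussian density of covariance `L⁻¹`. -/
theorem exp_neg_mul_le_integral_of_gradient_lipschitz {d : ℕ} {L : ℝ} (hL : 0 < L)
    {f : EuclideanSpace ℝ (Fin d) → ℝ} (hf : Differentiable ℝ f)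
    (hlip : ∀ x y, ‖gradient f x - gradient f y‖ ≤ L * ‖x - y‖)
    (hint : Integrable (fun x => Real.exp (-f x))) (x : EuclideanSpace ℝ (Fin d)) :
    Real.exp (-f x) * (2 * π / L) ^ ((d : ℝ) / 2) ≤ ∫ y, Real.exp (-f y) := by
  have hgauss : ∫ u : EuclideanSpace ℝ (Fin d), Real.exp (-(L / 2) * ‖u‖ ^ 2)
      = (2 * π / L) ^ ((d : ℝ) / 2) := by
    rw [GaussianFourier.integral_rexp_neg_mul_sq_norm (by positivity)]
    simp only [finrank_euclideanSpace, Fintype.card_fin]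
    congr 1
    field_simp
  have hpt (u : EuclideanSpace ℝ (Fin d)) :
      2 * Real.exp (-f x) * Real.exp (-(L / 2) * ‖u‖ ^ 2)
        ≤ Real.exp (-f (x + u)) + Real.exp (-f (x - u)) := by
    have h := add_le_of_gradient_lipschitz hf hlip x u
    set a := f (x + u)
    set b := f (x - u)
    have h1 : Real.exp (-f x) * Real.exp (-(L / 2) * ‖u‖ ^ 2)
        ≤ Real.exp (-a / 2) * Real.exp (-b / 2) := by
      rw [← Real.exp_add, ← Real.exp_add, Real.exp_le_exp]
      linarith
    have ha : Real.exp (-a) = Real.exp (-a / 2) ^ 2 := by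
      rw [← Real.exp_nat_mul]; push_cast; ring_nf
    have hb : Real.exp (-b) = Real.exp (-b / 2) ^ 2 := by
      rw [← Real.exp_nat_mul]; push_cast; ring_nf
    rw [ha, hb]
    nlinarith [sq_nonneg (Real.exp (-a / 2) - Real.exp (-b / 2))]
  have hadd : Integrable fun u => Real.exp (-f (x + u)) := hint.comp_add_left x
  have hsub : Integrable fun u => Real.exp (-f (x - u)) := hint.comp_sub_left x
  have hmono := integral_mono_of_nonneg (μ := volume)
    (Filter.Eventually.of_forall fun u => by positivity)
    (hadd.add hsub) (Filter.Eventually.of_forall hpt)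
  simp only [Pi.add_apply] at hmono
  rw [integral_const_mul, hgauss, integral_add hadd hsub,
    integral_add_left_eq_self (fun y => Real.exp (-f y)) x,
    integral_sub_left_eq_self (fun y => Real.exp (-f y)) volume x] at hmono
  linarith

/-- With `f` continuously differentiable with `L`-Lipschitz gradient,
`p = e^{-f}/∫ e^{-f}` a probability density with finite second moment `M`, the KL divergence
from `p` to the standard Gaussian `γ_d` satisfies `KL(p ‖ γ_d) ≤ L·d + M`. -/
theorem stmt_1 {d : ℕ} (hd : 1 ≤ d) (L : ℝ) (hL : 0 < L)
    (f : EuclideanSpace ℝ (Fin d) → ℝ)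
    (hf : ContDiff ℝ 1 f)
    (hlip : ∀ x y, ‖gradient f x - gradient f y‖ ≤ L * ‖x - y‖)
    (hint : Integrable (fun x => Real.exp (-f x)))
    (p : EuclideanSpace ℝ (Fin d) → ℝ)
    (hp : p = fun x => Real.exp (-f x) / ∫ y, Real.exp (-f y))
    (M : ℝ) (hM : M = ∫ x, p x * ‖x‖ ^ 2)
    (hMint : Integrable (fun x => p x * ‖x‖ ^ 2))
    (γ : EuclideanSpace ℝ (Fin d) → ℝ)
    (hγ : γ = fun x => (2 * π) ^ (-(d : ℝ) / 2) * Real.exp (-‖x‖ ^ 2 / 2)) :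
    ∫ x, p x * Real.log (p x / γ x) ≤ L * d + M := by
  have hZ : 0 < ∫ y, Real.exp (-f y) := integral_exp_pos hint
  have hpos (x) : 0 < p x := by rw [hp]; positivity
  have hM0 : 0 ≤ M := hM ▸ integral_nonneg fun x => mul_nonneg (hpos x).le (by positivity)
  by_cases hi : Integrable fun x => p x * Real.log (p x / γ x)
  swap
  · rw [integral_undef hi]
    positivity
  have hpint : Integrable p := hp ▸ hint.div_const _
  have hp1 : ∫ x, p x = 1 := by
    simp only [hp]
    rw [integral_div, div_self hZ.ne']
  have hlog (x) : Real.log (p x / γ x) ≤ L * d + ‖x‖ ^ 2 := by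
    have hb : Real.log (p x) ≤ (d : ℝ) / 2 * (Real.log L - Real.log (2 * π)) := by
      have h := exp_neg_mul_le_integral_of_gradient_lipschitz hL
        (hf.differentiable one_ne_zero) hlip hint x
      have h1 : p x * (2 * π / L) ^ ((d : ℝ) / 2) ≤ 1 := by
        rw [hp, div_mul_eq_mul_div]
        exact (div_le_one hZ).2 h
      have h2 := Real.log_nonpos (mul_nonneg (hpos x).le (by positivity)) h1
      rw [Real.log_mul (hpos x).ne' (by positivity), Real.log_rpow (by positivity),
        Real.log_div (by positivity) hL.ne'] at h2
      linarith
    have hg : Real.log (γ x) = -(d : ℝ) / 2 * Real.log (2 * π) + -‖x‖ ^ 2 / 2 := by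
      rw [hγ, Real.log_mul (by positivity) (by positivity), Real.log_rpow (by positivity),
        Real.log_exp]
    have hγpos : γ x ≠ 0 := by rw [hγ]; positivity
    rw [Real.log_div (hpos x).ne' hγpos, hg]
    have hLL : (d : ℝ) / 2 * Real.log L ≤ d / 2 * L := by
      gcongr
      exact Real.log_le_self hL.le
    have : 0 ≤ (d : ℝ) * L := by positivity
    linarith [sq_nonneg ‖x‖]
  calc ∫ x, p x * Real.log (p x / γ x) ≤ ∫ x, (L * d * p x + p x * ‖x‖ ^ 2) := by
        refine integral_mono hi ((hpint.const_mul _).add hMint) fun x => ?_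
        linarith [mul_le_mul_of_nonneg_left (hlog x) (hpos x).le]
    _ = L * d + M := by
        rw [integral_add (hpint.const_mul _) hMint, integral_const_mul, hp1, hM, mul_one]
end

section
/- Let d ≥ 1 and L > 0. Let p_* be a probability density on ℝ^d whose score ∇ log p_* is L-Lipschitz and whose second moment M := ∫ p_*(x)‖x‖² dx is finite. For t ≥ 0 let p_t denote the Ornstein–Uhlenbeck marginal at time t started from p_*, i.e. the density of e^{−t}X₀ + √(1 − e^{−2t}) Z where X₀ ~ p_* and Z is an independent standard Gaussian vector on ℝ^d. Then for every t ≥ 0, KL(p_t ‖ γ_d) ≤ (L·d + M)·e^{−t/2}, where γ_d is the standard Gaussian density on ℝ^d. -/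
open MeasureTheory Real

/-- The Ornstein–Uhlenbeck marginal at time `t` started from the density `p₀` on `ℝ^d`;
at `t = 0` it is `p₀` itself. -/
noncomputable def ouMarginal {d : ℕ} (p₀ : EuclideanSpace ℝ (Fin d) → ℝ) (t : ℝ)
    (x : EuclideanSpace ℝ (Fin d)) : ℝ :=
  if t = 0 then p₀ x
  else ∫ x₀, p₀ x₀ * ((2 * π * (1 - Real.exp (-2 * t))) ^ (-(d : ℝ) / 2) *
    Real.exp (-‖x - Real.exp (-t) • x₀‖ ^ 2 / (2 * (1 - Real.exp (-2 * t)))))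

theorem le_log_of_lipschitz_score {E : Type*} [NormedAddCommGroup E] [InnerProductSpace ℝ E]
    [CompleteSpace E] {f : E → ℝ} {L : ℝ} (hf : Differentiable ℝ f)
    (hL : ∀ x y, ‖gradient f x - gradient f y‖ ≤ L * ‖x - y‖) (x u : E) :
    f x + inner ℝ (gradient f x) u - L / 2 * ‖u‖ ^ 2 ≤ f (x + u) := by
  have hderiv : ∀ τ : ℝ, HasDerivAt
      (fun τ : ℝ => f (x + τ • u) - τ * inner ℝ (gradient f x) u + L / 2 * ‖u‖ ^ 2 * τ ^ 2)
      (inner ℝ (gradient f (x + τ • u)) u - inner ℝ (gradient f x) u + L * ‖u‖ ^ 2 * τ) τ := by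
    intro τ
    have h1 : HasDerivAt (fun τ : ℝ => x + τ • u) u τ := by
      simpa using ((hasDerivAt_id τ).smul_const u).const_add x
    have h2 := ((hf (x + τ • u)).hasGradientAt.hasFDerivAt).comp_hasDerivAt τ h1
    have h3 := (h2.sub ((hasDerivAt_id τ).mul_const (inner ℝ (gradient f x) u))).add
      ((hasDerivAt_pow 2 τ).const_mul (L / 2 * ‖u‖ ^ 2))
    refine h3.congr_deriv ?_
    simp
    ring
  have hmono : MonotoneOn
      (fun τ : ℝ => f (x + τ • u) - τ * inner ℝ (gradient f x) u + L / 2 * ‖u‖ ^ 2 * τ ^ 2)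
      (Set.Icc 0 1) := by
    refine monotoneOn_of_deriv_nonneg (convex_Icc 0 1)
      (fun τ _ => (hderiv τ).continuousAt.continuousWithinAt)
      (fun τ _ => (hderiv τ).differentiableAt.differentiableWithinAt) ?_
    intro τ hτ
    rw [interior_Icc] at hτ
    rw [(hderiv τ).deriv, ← inner_sub_left]
    have h1 := abs_real_inner_le_norm (gradient f (x + τ • u) - gradient f x) u
    have h2 := hL (x + τ • u) x
    rw [add_sub_cancel_left, norm_smul, Real.norm_of_nonneg hτ.1.le] at h2
    have h3 := mul_le_mul_of_nonneg_right h2 (norm_nonneg u)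
    have h4 := neg_abs_le (inner ℝ (gradient f (x + τ • u) - gradient f x) u)
    nlinarith
  have h := hmono (Set.left_mem_Icc.2 zero_le_one) (Set.right_mem_Icc.2 zero_le_one) zero_le_one
  simp only [zero_smul, add_zero, zero_mul, sub_zero, ne_eq, OfNat.ofNat_ne_zero, not_false_eq_true,
    zero_pow, mul_zero, one_smul, one_mul, one_pow, mul_one] at h
  linarith

section Gaussian

variable {d : ℕ}

theorem integrable_exp_neg_mul_sq_norm {b : ℝ} (hb : 0 < b) :
    Integrable (fun v : EuclideanSpace ℝ (Fin d) => rexp (-b * ‖v‖ ^ 2)) := by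
  refine Integrable.of_integral_ne_zero ?_
  rw [GaussianFourier.integral_rexp_neg_mul_sq_norm hb]
  positivity

theorem log_le_of_lipschitz_score {p : EuclideanSpace ℝ (Fin d) → ℝ} {L : ℝ} (hL : 0 < L) (hpos : ∀ x, 0 < p x)
    (hone : ∫ x, p x = 1) (hdiff : Differentiable ℝ p)
    (hscore : ∀ x y, ‖gradient (fun z => Real.log (p z)) x -
      gradient (fun z => Real.log (p z)) y‖ ≤ L * ‖x - y‖) (x : EuclideanSpace ℝ (Fin d)) :
    Real.log (p x) ≤ d / 2 * (Real.log L - Real.log (2 * π)) := by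
  have hint : Integrable p := Integrable.of_integral_ne_zero (by rw [hone]; exact one_ne_zero)
  have hlow := le_log_of_lipschitz_score (fun z => (hdiff z).log (hpos z).ne') hscore x
  set s := gradient (fun z => Real.log (p z)) x
  have hpt : ∀ u : EuclideanSpace ℝ (Fin d), 2 * p x * rexp (-(L / 2) * ‖u‖ ^ 2) ≤ p (x + u) + p (x - u) := by
    intro u
    have h1 := Real.exp_le_exp.2 (hlow u)
    have h2 := Real.exp_le_exp.2 (hlow (-u))
    rw [Real.exp_log (hpos _)] at h1 h2
    rw [norm_neg, inner_neg_right, ← sub_eq_add_neg x u] at h2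
    have e1 : rexp (Real.log (p x) + inner ℝ s u - L / 2 * ‖u‖ ^ 2)
        = p x * rexp (-(L / 2) * ‖u‖ ^ 2) * rexp (inner ℝ s u) := by
      rw [← Real.exp_log (hpos x), ← Real.exp_add, ← Real.exp_add, Real.exp_log (hpos x)]
      ring_nf
    have e2 : rexp (Real.log (p x) + -inner ℝ s u - L / 2 * ‖u‖ ^ 2)
        = p x * rexp (-(L / 2) * ‖u‖ ^ 2) * rexp (-inner ℝ s u) := by
      rw [← Real.exp_log (hpos x), ← Real.exp_add, ← Real.exp_add, Real.exp_log (hpos x)]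
      ring_nf
    rw [e1] at h1
    rw [e2] at h2
    have h3 : 2 ≤ rexp (inner ℝ s u) + rexp (-inner ℝ s u) := by
      linarith [Real.add_one_le_exp (inner ℝ s u), Real.add_one_le_exp (-inner ℝ s u)]
    have h4 : 0 ≤ p x * rexp (-(L / 2) * ‖u‖ ^ 2) :=
      mul_nonneg (hpos x).le (Real.exp_nonneg _)
    nlinarith
  have hmono := integral_mono ((integrable_exp_neg_mul_sq_norm (half_pos hL)).const_mul (2 * p x))
    ((hint.comp_add_left x).add (hint.comp_sub_left x)) hpt
  simp only [Pi.add_apply] at hmono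
  rw [integral_add (hint.comp_add_left x) (hint.comp_sub_left x), integral_const_mul,
    integral_add_left_eq_self p x, integral_sub_left_eq_self p volume x, hone,
    GaussianFourier.integral_rexp_neg_mul_sq_norm (half_pos hL), finrank_euclideanSpace_fin] at hmono
  have hA : (0 : ℝ) < (π / (L / 2)) ^ ((d : ℝ) / 2) := by positivity
  have h1 : p x * (π / (L / 2)) ^ ((d : ℝ) / 2) ≤ 1 := by linarith
  have h2 := Real.log_le_log (mul_pos (hpos x) hA) h1
  rw [Real.log_one, Real.log_mul (hpos x).ne' hA.ne', Real.log_rpow (by positivity),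
    show π / (L / 2) = 2 * π / L by field_simp, Real.log_div (by positivity) hL.ne'] at h2
  linarith

theorem hasDerivAt_integral_exp_neg_mul_sq_norm {b : ℝ} (hb : 0 < b) :
    Integrable (fun v : EuclideanSpace ℝ (Fin d) => -‖v‖ ^ 2 * rexp (-b * ‖v‖ ^ 2)) ∧
    HasDerivAt (fun b : ℝ => ∫ v : EuclideanSpace ℝ (Fin d), rexp (-b * ‖v‖ ^ 2))
      (∫ v : EuclideanSpace ℝ (Fin d), -‖v‖ ^ 2 * rexp (-b * ‖v‖ ^ 2)) b := by
  refine hasDerivAt_integral_of_dominated_loc_of_deriv_le 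
    (F := fun b v => rexp (-b * ‖v‖ ^ 2)) (F' := fun b v => -‖v‖ ^ 2 * rexp (-b * ‖v‖ ^ 2))
    (x₀ := b) (s := Set.Ioi (b / 2))
    (bound := fun v => 4 / b * rexp (-(b / 4) * ‖v‖ ^ 2)) (Ioi_mem_nhds (by linarith))
    (.of_forall fun c => Continuous.aestronglyMeasurable (by fun_prop))
    (integrable_exp_neg_mul_sq_norm hb) (Continuous.aestronglyMeasurable (by fun_prop))
    (.of_forall fun v c hc => ?_)
    ((integrable_exp_neg_mul_sq_norm (by positivity)).const_mul _)
    (.of_forall fun v c hc => ?_)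
  · rw [norm_mul, norm_neg, Real.norm_of_nonneg (by positivity), Real.norm_of_nonneg (by positivity)]
    have h1 : ‖v‖ ^ 2 ≤ 4 / b * rexp (b / 4 * ‖v‖ ^ 2) := by
      rw [div_mul_eq_mul_div, le_div_iff₀ hb]
      linarith [Real.add_one_le_exp (b / 4 * ‖v‖ ^ 2)]
    have h2 : rexp (-c * ‖v‖ ^ 2) ≤ rexp (-(b / 2) * ‖v‖ ^ 2) := by
      apply Real.exp_le_exp.2
      have : b / 2 < c := hc
      nlinarith [sq_nonneg ‖v‖]
    calc ‖v‖ ^ 2 * rexp (-c * ‖v‖ ^ 2)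
        ≤ 4 / b * rexp (b / 4 * ‖v‖ ^ 2) * rexp (-(b / 2) * ‖v‖ ^ 2) := by gcongr
      _ = 4 / b * rexp (-(b / 4) * ‖v‖ ^ 2) := by
        rw [mul_assoc, ← Real.exp_add]; ring_nf
  · have h := (((hasDerivAt_id c).neg).mul_const (‖v‖ ^ 2)).exp
    refine h.congr_deriv ?_
    simp
    ring

theorem integral_sq_norm_mul_exp_neg_mul_sq_norm {b : ℝ} (hb : 0 < b) :
    ∫ v : EuclideanSpace ℝ (Fin d), ‖v‖ ^ 2 * rexp (-b * ‖v‖ ^ 2) = d / (2 * b) * (π / b) ^ ((d : ℝ) / 2) := by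
  have h1 := (hasDerivAt_integral_exp_neg_mul_sq_norm (d := d) hb).2
  have h2 : HasDerivAt (fun b : ℝ => ∫ v : EuclideanSpace ℝ (Fin d), rexp (-b * ‖v‖ ^ 2))
      (-(d / (2 * b) * (π / b) ^ ((d : ℝ) / 2))) b := by
    have h3 : HasDerivAt (fun b : ℝ => (π / b) ^ ((d : ℝ) / 2))
        (-(d / (2 * b) * (π / b) ^ ((d : ℝ) / 2))) b := by
      have h4 : HasDerivAt (fun b : ℝ => π / b) (-(π / b ^ 2)) b := by
        have := (hasDerivAt_inv hb.ne').const_mul π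
        refine this.congr_deriv ?_
        field_simp
      have hpos : 0 < π / b := by positivity
      refine (h4.rpow_const (p := (d : ℝ) / 2) (Or.inl hpos.ne')).congr_deriv ?_
      rw [Real.rpow_sub_one hpos.ne']
      field_simp
    refine h3.congr_of_eventuallyEq ?_
    filter_upwards [Ioi_mem_nhds hb] with c hc
    rw [GaussianFourier.integral_rexp_neg_mul_sq_norm hc, finrank_euclideanSpace_fin]
  have h5 := h1.unique h2
  simp only [neg_mul, integral_neg] at h5 ⊢
  linarith

/-- The density of the centered Gaussian on `ℝ^d` with covariance `s • 1`. -/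
noncomputable def gaussianDensity (s : ℝ) (z : EuclideanSpace ℝ (Fin d)) : ℝ :=
  (2 * π * s) ^ (-(d : ℝ) / 2) * rexp (-‖z‖ ^ 2 / (2 * s))

theorem gaussianDensity_pos {s : ℝ} (hs : 0 < s) (z : EuclideanSpace ℝ (Fin d)) :
    0 < gaussianDensity s z := by
  unfold gaussianDensity
  positivity

@[fun_prop]
theorem continuous_gaussianDensity (s : ℝ) :
    Continuous (gaussianDensity s : EuclideanSpace ℝ (Fin d) → ℝ) := by
  unfold gaussianDensity
  fun_prop

theorem log_gaussianDensity {s : ℝ} (hs : 0 < s) (z : EuclideanSpace ℝ (Fin d)) :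
    Real.log (gaussianDensity s z)
      = -(d / 2) * (Real.log (2 * π) + Real.log s) - 1 / (2 * s) * ‖z‖ ^ 2 := by
  unfold gaussianDensity
  rw [Real.log_mul (by positivity) (by positivity), Real.log_exp, Real.log_rpow (by positivity),
    Real.log_mul (by positivity) hs.ne']
  ring

theorem gaussianDensity_eq (s : ℝ) (z : EuclideanSpace ℝ (Fin d)) :
    gaussianDensity s z = (2 * π * s) ^ (-(d : ℝ) / 2) * rexp (-(1 / (2 * s)) * ‖z‖ ^ 2) := by
  unfold gaussianDensity
  ring_nf

theorem integrable_gaussianDensity {s : ℝ} (hs : 0 < s) :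
    Integrable (gaussianDensity s : EuclideanSpace ℝ (Fin d) → ℝ) := by
  simp_rw [funext (gaussianDensity_eq s)]
  exact (integrable_exp_neg_mul_sq_norm (by positivity)).const_mul _

theorem gaussianDensity_normalization {s : ℝ} (hs : 0 < s) :
    (2 * π * s) ^ (-(d : ℝ) / 2) * (π / (1 / (2 * s))) ^ ((d : ℝ) / 2) = 1 := by
  rw [show π / (1 / (2 * s)) = 2 * π * s by field_simp, ← Real.rpow_add (by positivity)]
  ring_nf
  exact Real.rpow_zero _

theorem integral_gaussianDensity {s : ℝ} (hs : 0 < s) :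
    ∫ z : EuclideanSpace ℝ (Fin d), gaussianDensity s z = 1 := by
  simp_rw [gaussianDensity_eq s]
  rw [integral_const_mul, GaussianFourier.integral_rexp_neg_mul_sq_norm (by positivity),
    finrank_euclideanSpace_fin, gaussianDensity_normalization hs]

theorem integrable_sq_norm_mul_gaussianDensity {s : ℝ} (hs : 0 < s) :
    Integrable (fun z : EuclideanSpace ℝ (Fin d) => ‖z‖ ^ 2 * gaussianDensity s z) := by
  have hb : 0 < 1 / (2 * s) := by positivity
  refine ((hasDerivAt_integral_exp_neg_mul_sq_norm (d := d) hb).1.const_mul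
    (-(2 * π * s) ^ (-(d : ℝ) / 2))).congr (.of_forall fun z => ?_)
  simp only [gaussianDensity_eq]
  ring

theorem integral_sq_norm_mul_gaussianDensity {s : ℝ} (hs : 0 < s) :
    ∫ z : EuclideanSpace ℝ (Fin d), ‖z‖ ^ 2 * gaussianDensity s z = d * s := by
  have hb : 0 < 1 / (2 * s) := by positivity
  simp_rw [gaussianDensity_eq s, mul_left_comm]
  rw [integral_const_mul, integral_sq_norm_mul_exp_neg_mul_sq_norm hb, mul_left_comm,
    gaussianDensity_normalization hs]
  field_simp

theorem integrable_inner_mul_gaussianDensity {s : ℝ} (hs : 0 < s)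
    (c : EuclideanSpace ℝ (Fin d)) :
    Integrable (fun z : EuclideanSpace ℝ (Fin d) => inner ℝ z c * gaussianDensity s z) := by
  refine ((integrable_sq_norm_mul_gaussianDensity hs).add
    ((integrable_gaussianDensity hs).const_mul (‖c‖ ^ 2))).mono'
    (Continuous.aestronglyMeasurable (by fun_prop)) (.of_forall fun z => ?_)
  have hg := gaussianDensity_pos hs z
  rw [norm_mul, Real.norm_of_nonneg hg.le, Pi.add_apply, ← add_mul]
  refine mul_le_mul_of_nonneg_right ((abs_real_inner_le_norm z c).trans ?_) hg.le
  nlinarith [sq_nonneg (‖z‖ - ‖c‖), sq_nonneg ‖z‖, sq_nonneg ‖c‖]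

theorem integral_inner_mul_gaussianDensity (s : ℝ) (c : EuclideanSpace ℝ (Fin d)) :
    ∫ z : EuclideanSpace ℝ (Fin d), inner ℝ z c * gaussianDensity s z = 0 := by
  have h := integral_neg_eq_self
    (fun z : EuclideanSpace ℝ (Fin d) => inner ℝ z c * gaussianDensity s z) volume
  simp only [gaussianDensity, norm_neg, inner_neg_left, neg_mul, integral_neg] at h ⊢
  linarith

theorem integral_add_add {α : Type*} [MeasurableSpace α] {μ : Measure α} {f g h : α → ℝ}
    (hf : Integrable f μ) (hg : Integrable g μ) (hh : Integrable h μ) :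
    ∫ x, f x + g x + h x ∂μ = ∫ x, f x ∂μ + ∫ x, g x ∂μ + ∫ x, h x ∂μ :=
  (integral_add (hf.add hg) hh).trans (congrArg (· + _) (integral_add hf hg))

theorem sq_norm_add_mul_gaussianDensity (s : ℝ) (z c : EuclideanSpace ℝ (Fin d)) :
    ‖z + c‖ ^ 2 * gaussianDensity s z = ‖z‖ ^ 2 * gaussianDensity s z +
      2 * (inner ℝ z c * gaussianDensity s z) + ‖c‖ ^ 2 * gaussianDensity s z := by
  rw [norm_add_sq_real]
  ring

theorem integrable_sq_norm_mul_gaussianDensity_sub {s : ℝ} (hs : 0 < s)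
    (c : EuclideanSpace ℝ (Fin d)) :
    Integrable (fun x : EuclideanSpace ℝ (Fin d) => ‖x‖ ^ 2 * gaussianDensity s (x - c)) := by
  have h : Integrable fun z : EuclideanSpace ℝ (Fin d) => ‖z + c‖ ^ 2 * gaussianDensity s z := by
    simp_rw [sq_norm_add_mul_gaussianDensity]
    exact ((integrable_sq_norm_mul_gaussianDensity hs).add
      ((integrable_inner_mul_gaussianDensity hs c).const_mul 2)).add
      ((integrable_gaussianDensity hs).const_mul _)
  simpa using h.comp_sub_right c

theorem integral_sq_norm_mul_gaussianDensity_sub {s : ℝ} (hs : 0 < s)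
    (c : EuclideanSpace ℝ (Fin d)) :
    ∫ x : EuclideanSpace ℝ (Fin d), ‖x‖ ^ 2 * gaussianDensity s (x - c) = ‖c‖ ^ 2 + d * s := by
  have h := integral_sub_right_eq_self
    (fun z : EuclideanSpace ℝ (Fin d) => ‖z + c‖ ^ 2 * gaussianDensity s z) (μ := volume) c
  simp only [sub_add_cancel] at h
  rw [h]
  simp_rw [sq_norm_add_mul_gaussianDensity]
  have h1 := integrable_sq_norm_mul_gaussianDensity (d := d) hs
  have h2 := (integrable_inner_mul_gaussianDensity hs c).const_mul 2
  have h3 := (integrable_gaussianDensity (d := d) hs).const_mul (‖c‖ ^ 2)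
  rw [integral_add_add h1 h2 h3, integral_const_mul, integral_const_mul,
    integral_inner_mul_gaussianDensity, integral_gaussianDensity hs,
    integral_sq_norm_mul_gaussianDensity hs]
  ring

theorem integral_gaussianDensity_sub_smul {s a : ℝ} (hs : 0 < s) (ha : 0 < a)
    (x : EuclideanSpace ℝ (Fin d)) :
    Integrable (fun y => gaussianDensity s (x - a • y)) ∧
    ∫ y : EuclideanSpace ℝ (Fin d), gaussianDensity s (x - a • y) = (a ^ d)⁻¹ := by
  refine ⟨((integrable_gaussianDensity hs).comp_sub_left x).comp_smul ha.ne', ?_⟩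
  rw [Measure.integral_comp_smul volume (fun z => gaussianDensity s (x - z)) a,
    integral_sub_left_eq_self (gaussianDensity s) volume x, integral_gaussianDensity hs,
    finrank_euclideanSpace_fin, abs_of_pos (by positivity), smul_eq_mul, mul_one]

theorem integrable_prod_of_integral_eq {α : Type*} [MeasureSpace α]
    [SFinite (volume : Measure α)] {p m : α → ℝ} {f : α → α → ℝ}
    (hp : ∀ y, 0 ≤ p y) (hf : ∀ x y, 0 ≤ f x y) (hpm : Measurable p)
    (hfm : Measurable (Function.uncurry f)) (hfint : ∀ y, Integrable (fun x => f x y))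
    (hm : ∀ y, ∫ x, f x y = m y) (hpmint : Integrable (fun y => p y * m y)) :
    Integrable (Function.uncurry fun x y => p y * f x y) (volume.prod volume) ∧
    ∫ x, ∫ y, p y * f x y = ∫ y, p y * m y := by
  have hint : Integrable (Function.uncurry fun x y => p y * f x y) (volume.prod volume) := by
    have hmeas : Measurable (Function.uncurry fun x y => p y * f x y) :=
      (hpm.comp measurable_snd).mul hfm
    rw [integrable_prod_iff' hmeas.aestronglyMeasurable]
    refine ⟨.of_forall fun y => (hfint y).const_mul (p y), hpmint.congr (.of_forall fun y => ?_)⟩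
    simp only [Function.uncurry_apply_pair, norm_mul, Real.norm_of_nonneg (hp y),
      Real.norm_of_nonneg (hf _ y), integral_const_mul, hm]
  refine ⟨hint, ?_⟩
  rw [integral_integral_swap hint]
  simp_rw [integral_const_mul, hm]

theorem integrable_prod_quadratic_mul_gaussianDensity {p : EuclideanSpace ℝ (Fin d) → ℝ}
    (hp : ∀ y, 0 ≤ p y) (hpm : Measurable p) (hone : ∫ y, p y = 1)
    (hMint : Integrable (fun y => p y * ‖y‖ ^ 2)) {s : ℝ} (hs : 0 < s) (a b c : ℝ) :
    Integrable (Function.uncurry fun x y : EuclideanSpace ℝ (Fin d) =>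
      p y * ((c + ‖x‖ ^ 2 / 2 - b * ‖x - a • y‖ ^ 2) * gaussianDensity s (x - a • y)))
      (volume.prod volume) ∧
    ∫ x : EuclideanSpace ℝ (Fin d), ∫ y,
      p y * ((c + ‖x‖ ^ 2 / 2 - b * ‖x - a • y‖ ^ 2) * gaussianDensity s (x - a • y))
      = c + (a ^ 2 * (∫ y, p y * ‖y‖ ^ 2) + d * s) / 2 - b * (d * s) := by
  have hpint : Integrable p := Integrable.of_integral_ne_zero (by rw [hone]; exact one_ne_zero)
  have hg : ∀ x y : EuclideanSpace ℝ (Fin d), 0 ≤ gaussianDensity s (x - a • y) :=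
    fun x y => (gaussianDensity_pos hs _).le
  have hM2 : Integrable fun y => p y * (‖a • y‖ ^ 2 + d * s) := by
    refine ((hMint.const_mul (a ^ 2)).add (hpint.mul_const (d * s))).congr (.of_forall fun y => ?_)
    simp only [Pi.add_apply, norm_smul, mul_pow, Real.norm_eq_abs, sq_abs]
    ring
  obtain ⟨i0, e0⟩ := integrable_prod_of_integral_eq (p := p) (m := fun _ => 1)
    (f := fun x y => gaussianDensity s (x - a • y)) hp hg hpm
    (Continuous.measurable (by fun_prop))
    (fun y => (integrable_gaussianDensity hs).comp_sub_right (a • y))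
    (fun y => (integral_sub_right_eq_self (gaussianDensity s) (a • y)).trans
      (integral_gaussianDensity hs)) (by simpa using hpint)
  obtain ⟨i1, e1⟩ := integrable_prod_of_integral_eq (p := p) (m := fun y => ‖a • y‖ ^ 2 + d * s)
    (f := fun x y => ‖x‖ ^ 2 * gaussianDensity s (x - a • y)) hp
    (fun x y => mul_nonneg (sq_nonneg _) (hg x y)) hpm
    (Continuous.measurable (by fun_prop))
    (fun y => integrable_sq_norm_mul_gaussianDensity_sub hs (a • y))
    (fun y => integral_sq_norm_mul_gaussianDensity_sub hs (a • y)) hM2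
  obtain ⟨i2, e2⟩ := integrable_prod_of_integral_eq (p := p) (m := fun _ => d * s)
    (f := fun x y => ‖x - a • y‖ ^ 2 * gaussianDensity s (x - a • y)) hp
    (fun x y => mul_nonneg (sq_nonneg _) (hg x y)) hpm
    (Continuous.measurable (by fun_prop))
    (fun y => (integrable_sq_norm_mul_gaussianDensity hs).comp_sub_right (a • y))
    (fun y => (integral_sub_right_eq_self (fun z => ‖z‖ ^ 2 * gaussianDensity s z) (a • y)).trans
      (integral_sq_norm_mul_gaussianDensity hs)) (hpint.mul_const _)
  have e0' := integral_integral i0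
  have e1' := integral_integral i1
  have e2' := integral_integral i2
  replace i0 := i0.const_mul c
  replace i1 := i1.const_mul (1 / 2)
  replace i2 := i2.const_mul (-b)
  have heq : (fun z : EuclideanSpace ℝ (Fin d) × EuclideanSpace ℝ (Fin d) =>
      p z.2 * ((c + ‖z.1‖ ^ 2 / 2 - b * ‖z.1 - a • z.2‖ ^ 2) *
        gaussianDensity s (z.1 - a • z.2))) =
      fun z => c * (p z.2 * gaussianDensity s (z.1 - a • z.2)) +
        1 / 2 * (p z.2 * (‖z.1‖ ^ 2 * gaussianDensity s (z.1 - a • z.2))) +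
        -b * (p z.2 * (‖z.1 - a • z.2‖ ^ 2 * gaussianDensity s (z.1 - a • z.2))) := by
    funext z
    ring
  have hint : Integrable (fun z : EuclideanSpace ℝ (Fin d) × EuclideanSpace ℝ (Fin d) =>
      p z.2 * ((c + ‖z.1‖ ^ 2 / 2 - b * ‖z.1 - a • z.2‖ ^ 2) *
        gaussianDensity s (z.1 - a • z.2))) (volume.prod volume) := by
    rw [heq]
    exact (i0.add i1).add i2
  refine ⟨hint, ?_⟩
  rw [integral_integral hint, heq]
  refine (integral_add_add i0 i1 i2).trans ?_
  simp only [Function.uncurry] at e0' e1' e2' ⊢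
  rw [integral_const_mul, integral_const_mul, integral_const_mul, ← e0', ← e1', ← e2', e0, e1, e2,
    integral_mul_const, integral_mul_const, hone]
  have hM3 : ∫ y, p y * (‖a • y‖ ^ 2 + d * s) = a ^ 2 * (∫ y, p y * ‖y‖ ^ 2) + d * s := by
    have e := integral_add (hMint.const_mul (a ^ 2)) (hpint.mul_const (d * s))
    rw [integral_const_mul, integral_mul_const, hone, one_mul] at e
    rw [← e]
    refine integral_congr_ae (.of_forall fun y => ?_)
    simp only [norm_smul, mul_pow, Real.norm_eq_abs, sq_abs]
    ring
  rw [hM3]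
  ring

/-- Integrating a pointwise bound by a quadratically weighted Gaussian mixture. -/
theorem integral_le_of_ae_le_quadratic {p F : EuclideanSpace ℝ (Fin d) → ℝ}
    (hp : ∀ y, 0 ≤ p y) (hpm : Measurable p) (hone : ∫ y, p y = 1)
    (hMint : Integrable (fun y => p y * ‖y‖ ^ 2)) {s : ℝ} (hs : 0 < s) (a b c : ℝ)
    (hF : Integrable F)
    (hle : ∀ᵐ x, Integrable (fun y =>
        p y * ((c + ‖x‖ ^ 2 / 2 - b * ‖x - a • y‖ ^ 2) * gaussianDensity s (x - a • y))) →
      F x ≤ ∫ y,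
        p y * ((c + ‖x‖ ^ 2 / 2 - b * ‖x - a • y‖ ^ 2) * gaussianDensity s (x - a • y))) :
    ∫ x, F x ≤ c + (a ^ 2 * (∫ y, p y * ‖y‖ ^ 2) + d * s) / 2 - b * (d * s) := by
  obtain ⟨hint, heq⟩ :=
    integrable_prod_quadratic_mul_gaussianDensity hp hpm hone hMint hs a b c
  rw [← heq]
  refine integral_mono_ae hF hint.integral_prod_left ?_
  filter_upwards [hle, hint.prod_right_ae] with x hx hi using hx hi

section Mixture

variable {p : EuclideanSpace ℝ (Fin d) → ℝ} {s a : ℝ}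

theorem mixture_pos (hpos : ∀ x, 0 < p x) (hs : 0 < s) {x : EuclideanSpace ℝ (Fin d)}
    (hi : Integrable fun y => p y * gaussianDensity s (x - a • y)) :
    0 < ∫ y, p y * gaussianDensity s (x - a • y) := by
  have hpt : ∀ y, 0 < p y * gaussianDensity s (x - a • y) :=
    fun y => mul_pos (hpos y) (gaussianDensity_pos hs _)
  rw [integral_pos_iff_support_of_nonneg (fun y => (hpt y).le) hi,
    show Function.support (fun y => p y * gaussianDensity s (x - a • y)) = Set.univ from
      Set.eq_univ_of_forall fun y => (hpt y).ne']
  exact Measure.measure_univ_pos.2 (NeZero.ne _)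

theorem integrable_mixture (hpos : ∀ x, 0 < p x) (hpm : Measurable p) (hs : 0 < s) (ha : 0 < a)
    {C : ℝ} (hC : ∀ y, Real.log (p y) ≤ C) (x : EuclideanSpace ℝ (Fin d)) :
    Integrable (fun y => p y * gaussianDensity s (x - a • y)) ∧
    Real.log (∫ y, p y * gaussianDensity s (x - a • y)) ≤ C - d * Real.log a := by
  obtain ⟨hg, heq⟩ := integral_gaussianDensity_sub_smul hs ha x
  have hle : ∀ y, p y * gaussianDensity s (x - a • y) ≤ rexp C * gaussianDensity s (x - a • y) :=
    fun y => mul_le_mul_of_nonneg_right ((Real.log_le_iff_le_exp (hpos y)).1 (hC y))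
      (gaussianDensity_pos hs _).le
  have hi : Integrable (fun y => p y * gaussianDensity s (x - a • y)) := by
    refine (hg.const_mul (rexp C)).mono'
      (hpm.mul (Continuous.measurable (by fun_prop))).aestronglyMeasurable (.of_forall fun y => ?_)
    rw [Real.norm_of_nonneg (mul_pos (hpos y) (gaussianDensity_pos hs _)).le]
    exact hle y
  refine ⟨hi, ?_⟩
  have h := Real.log_le_log (mixture_pos hpos hs hi) (integral_mono hi (hg.const_mul (rexp C)) hle)
  rw [integral_const_mul, heq, Real.log_mul (Real.exp_pos _).ne' (by positivity), Real.log_exp,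
    Real.log_inv, Real.log_pow] at h
  linarith

/-- Relative entropy bound for a Gaussian mixture from an upper bound on the mixed density. -/
theorem integral_mul_log_mixture_le_of_log_le (hpos : ∀ x, 0 < p x) (hpm : Measurable p)
    (hone : ∫ y, p y = 1) (hMint : Integrable (fun y => p y * ‖y‖ ^ 2)) (hs : 0 < s) (ha : 0 < a)
    {C : ℝ} (hC : ∀ y, Real.log (p y) ≤ C)
    (hF : Integrable fun x => (∫ y, p y * gaussianDensity s (x - a • y)) *
      Real.log ((∫ y, p y * gaussianDensity s (x - a • y)) / gaussianDensity 1 x)) :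
    ∫ x, (∫ y, p y * gaussianDensity s (x - a • y)) *
      Real.log ((∫ y, p y * gaussianDensity s (x - a • y)) / gaussianDensity 1 x)
      ≤ C - d * Real.log a + d / 2 * Real.log (2 * π)
        + (a ^ 2 * (∫ y, p y * ‖y‖ ^ 2) + d * s) / 2 := by
  have h := integral_le_of_ae_le_quadratic (fun y => (hpos y).le) hpm hone hMint hs a 0
    (C - d * Real.log a + d / 2 * Real.log (2 * π)) hF ?_
  · linarith
  refine .of_forall fun x _ => ?_
  obtain ⟨hi, hlog⟩ := integrable_mixture hpos hpm hs ha hC x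
  have hP := mixture_pos hpos hs hi
  rw [Real.log_div hP.ne' (gaussianDensity_pos one_pos x).ne', log_gaussianDensity one_pos]
  have heq : ∀ y, p y * ((C - d * Real.log a + d / 2 * Real.log (2 * π) + ‖x‖ ^ 2 / 2
      - 0 * ‖x - a • y‖ ^ 2) * gaussianDensity s (x - a • y)) =
      p y * gaussianDensity s (x - a • y) *
        (C - d * Real.log a + d / 2 * Real.log (2 * π) + ‖x‖ ^ 2 / 2) := fun y => by ring
  simp_rw [heq, integral_mul_const]
  refine mul_le_mul_of_nonneg_left ?_ hP.le
  rw [Real.log_one]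
  linarith

/-- Relative entropy bound for a Gaussian mixture from convexity of relative entropy. -/
theorem integral_mul_log_mixture_le (hpos : ∀ x, 0 < p x) (hpm : Measurable p)
    (hone : ∫ y, p y = 1) (hMint : Integrable (fun y => p y * ‖y‖ ^ 2)) (hs : 0 < s)
    (hi : ∀ x, Integrable fun y => p y * gaussianDensity s (x - a • y))
    (hF : Integrable fun x => (∫ y, p y * gaussianDensity s (x - a • y)) *
      Real.log ((∫ y, p y * gaussianDensity s (x - a • y)) / gaussianDensity 1 x)) :
    ∫ x, (∫ y, p y * gaussianDensity s (x - a • y)) *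
      Real.log ((∫ y, p y * gaussianDensity s (x - a • y)) / gaussianDensity 1 x)
      ≤ -(d / 2) * Real.log s + (a ^ 2 * (∫ y, p y * ‖y‖ ^ 2) + d * s) / 2 - d / 2 := by
  have hpint : Integrable p := Integrable.of_integral_ne_zero (by rw [hone]; exact one_ne_zero)
  have h := integral_le_of_ae_le_quadratic (fun y => (hpos y).le) hpm hone hMint hs a
    (1 / (2 * s)) (-(d / 2) * Real.log s) hF ?_
  · rwa [show 1 / (2 * s) * (d * s) = d / 2 by field_simp] at h
  refine .of_forall fun x hx => ?_
  have hP := mixture_pos hpos hs (hi x)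
  set P := ∫ y, p y * gaussianDensity s (x - a • y) with hPdef
  have hpt : ∀ y, p y * gaussianDensity s (x - a • y) * Real.log (P / gaussianDensity 1 x) ≤
      p y * ((-(d / 2) * Real.log s + ‖x‖ ^ 2 / 2 - 1 / (2 * s) * ‖x - a • y‖ ^ 2) *
        gaussianDensity s (x - a • y)) + p y * P + -1 * (p y * gaussianDensity s (x - a • y)) := by
    intro y
    have hg := gaussianDensity_pos hs (x - a • y)
    have h1 := Real.log_le_sub_one_of_pos (div_pos hP hg)
    rw [Real.log_div hP.ne' hg.ne', log_gaussianDensity hs] at h1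
    have h2 : gaussianDensity s (x - a • y) * (P / gaussianDensity s (x - a • y) - 1) =
      P - gaussianDensity s (x - a • y) := by field_simp
    have h3 := mul_le_mul_of_nonneg_left (mul_le_mul_of_nonneg_left h1 hg.le) (hpos y).le
    rw [h2] at h3
    rw [Real.log_div hP.ne' (gaussianDensity_pos one_pos x).ne', log_gaussianDensity one_pos,
      Real.log_one]
    linarith
  have h := integral_mono ((hi x).mul_const _)
    ((hx.add (hpint.mul_const P)).add ((hi x).const_mul (-1))) hpt
  refine (h.trans_eq' (integral_mul_const _ _)).trans_eq ?_
  refine (integral_add_add hx (hpint.mul_const P) ((hi x).const_mul (-1))).trans ?_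
  rw [integral_mul_const, integral_const_mul, hone]
  linarith

end Mixture

theorem nonneg_of_log_le {p : EuclideanSpace ℝ (Fin d) → ℝ} {C : ℝ}
    (hpos : ∀ x, 0 < p x) (hone : ∫ x, p x = 1) (hMint : Integrable (fun x => p x * ‖x‖ ^ 2))
    (hC : ∀ x, Real.log (p x) ≤ C) :
    0 ≤ C + d / 2 * Real.log (2 * π) + (∫ x, p x * ‖x‖ ^ 2) / 2 := by
  have hpint : Integrable p := Integrable.of_integral_ne_zero (by rw [hone]; exact one_ne_zero)
  have hpt : ∀ x, p x * 1 + -1 * gaussianDensity 1 x ≤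
      p x * (C + d / 2 * Real.log (2 * π)) + p x * ‖x‖ ^ 2 * (1 / 2) := by
    intro x
    have hg := gaussianDensity_pos one_pos x
    have h1 := Real.log_le_sub_one_of_pos (div_pos hg (hpos x))
    rw [Real.log_div hg.ne' (hpos x).ne', log_gaussianDensity one_pos, Real.log_one] at h1
    have h2 : p x * (gaussianDensity 1 x / p x - 1) = gaussianDensity 1 x - p x := by
      have := (hpos x).ne'
      field_simp
    have h3 := mul_le_mul_of_nonneg_left (h1.trans' (sub_le_sub_left (hC x) _)) (hpos x).le
    rw [h2] at h3
    linarith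
  have hg := integrable_gaussianDensity (d := d) one_pos
  have h := integral_mono ((hpint.mul_const 1).add (hg.const_mul (-1)))
    ((hpint.mul_const _).add (hMint.mul_const (1 / 2))) hpt
  have e1 := integral_add (hpint.mul_const 1) (hg.const_mul (-1))
  have e2 := integral_add (hpint.mul_const (C + d / 2 * Real.log (2 * π)))
    (hMint.mul_const (1 / 2))
  rw [integral_mul_const, integral_const_mul, hone, integral_gaussianDensity one_pos] at e1
  rw [integral_mul_const, integral_mul_const, hone] at e2
  have h' := (e1.symm.trans_le h).trans_eq e2
  linarith

theorem integral_mul_log_div_gaussianDensity_le {p : EuclideanSpace ℝ (Fin d) → ℝ} {C : ℝ}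
    (hpos : ∀ x, 0 < p x) (hone : ∫ x, p x = 1) (hMint : Integrable (fun x => p x * ‖x‖ ^ 2))
    (hC : ∀ x, Real.log (p x) ≤ C)
    (hF : Integrable fun x => p x * Real.log (p x / gaussianDensity 1 x)) :
    ∫ x, p x * Real.log (p x / gaussianDensity 1 x)
      ≤ C + d / 2 * Real.log (2 * π) + (∫ x, p x * ‖x‖ ^ 2) / 2 := by
  have hpint : Integrable p := Integrable.of_integral_ne_zero (by rw [hone]; exact one_ne_zero)
  have hpt : ∀ x, p x * Real.log (p x / gaussianDensity 1 x) ≤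
      p x * (C + d / 2 * Real.log (2 * π)) + p x * ‖x‖ ^ 2 * (1 / 2) := by
    intro x
    rw [Real.log_div (hpos x).ne' (gaussianDensity_pos one_pos x).ne', log_gaussianDensity one_pos,
      Real.log_one]
    linarith [mul_le_mul_of_nonneg_left (hC x) (hpos x).le]
  have h := integral_mono hF ((hpint.mul_const _).add (hMint.mul_const (1 / 2))) hpt
  have e := integral_add (hpint.mul_const (C + d / 2 * Real.log (2 * π)))
    (hMint.mul_const (1 / 2))
  rw [integral_mul_const, integral_mul_const, hone] at e
  have h' := h.trans_eq e
  linarith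

theorem ouMarginal_of_ne_zero (p : EuclideanSpace ℝ (Fin d) → ℝ) {t : ℝ} (ht : t ≠ 0)
    (x : EuclideanSpace ℝ (Fin d)) :
    ouMarginal p t x =
      ∫ y, p y * gaussianDensity (1 - rexp (-2 * t)) (x - rexp (-t) • y) := by
  rw [ouMarginal, if_neg ht]
  rfl

end Gaussian

/-- If `p_*` is a probability density on `ℝ^d` with `L`-Lipschitz score and
finite second moment `M`, then the OU marginals `p_t` started from `p_*` satisfy
`KL(p_t ‖ γ_d) ≤ (L·d + M)·e^{−t/2}` for all `t ≥ 0`. -/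
theorem stmt_2 {d : ℕ} (hd : 1 ≤ d) (L : ℝ) (hL : 0 < L)
    (pstar : EuclideanSpace ℝ (Fin d) → ℝ)
    (hmeas : Measurable pstar) (hpos : ∀ x, 0 < pstar x)
    (hone : ∫ x, pstar x = 1)
    (hdiff : Differentiable ℝ pstar)
    (hscore : ∀ x y, ‖gradient (fun z => Real.log (pstar z)) x -
      gradient (fun z => Real.log (pstar z)) y‖ ≤ L * ‖x - y‖)
    (M : ℝ) (hM : M = ∫ x, pstar x * ‖x‖ ^ 2)
    (hMint : Integrable (fun x => pstar x * ‖x‖ ^ 2))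
    (γ : EuclideanSpace ℝ (Fin d) → ℝ)
    (hγ : γ = fun x => (2 * π) ^ (-(d : ℝ) / 2) * Real.exp (-‖x‖ ^ 2 / 2)) :
    ∀ t : ℝ, 0 ≤ t →
      ∫ x, ouMarginal pstar t x * Real.log (ouMarginal pstar t x / γ x)
        ≤ (L * d + M) * Real.exp (-t / 2) := by
  intro t ht
  obtain rfl : γ = gaussianDensity 1 := by
    rw [hγ]
    funext x
    simp only [gaussianDensity, mul_one]
  have hC := log_le_of_lipschitz_score hL hpos hone hdiff hscore
  have hgibbs := nonneg_of_log_le hpos hone hMint hC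
  have hM0 : 0 ≤ M := hM ▸ integral_nonneg fun x => mul_nonneg (hpos x).le (sq_nonneg _)
  have hd0 : (0 : ℝ) < d := by exact_mod_cast hd
  have hlogL := mul_le_mul_of_nonneg_left (Real.log_le_sub_one_of_pos hL) hd0.le
  rw [← hM] at hgibbs
  have hlow : (d : ℝ) ≤ L * d + M := by linarith
  by_cases hF : Integrable fun x =>
      ouMarginal pstar t x * Real.log (ouMarginal pstar t x / gaussianDensity 1 x)
  swap
  · rw [integral_undef hF]
    have : 0 ≤ L * d + M := hd0.le.trans hlow
    positivity
  rcases ht.eq_or_lt with rfl | ht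
  · have hp : ouMarginal pstar 0 = pstar := funext fun x => if_pos rfl
    rw [hp] at hF ⊢
    have h := integral_mul_log_div_gaussianDensity_le hpos hone hMint hC hF
    rw [← hM] at h
    simp only [neg_zero, zero_div, Real.exp_zero, mul_one]
    linarith
  simp_rw [ouMarginal_of_ne_zero pstar ht.ne'] at hF ⊢
  set r := rexp (-t / 2) with hr
  have hr0 : 0 < r := Real.exp_pos _
  have hr1 : r < 1 := Real.exp_lt_one_iff.2 (by linarith)
  have ha : rexp (-t) = r ^ 2 := by rw [hr, ← Real.exp_nat_mul]; congr 1; push_cast; ring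
  have hq : rexp (-2 * t) = r ^ 4 := by rw [hr, ← Real.exp_nat_mul]; congr 1; push_cast; ring
  have hs : 0 < 1 - rexp (-2 * t) := sub_pos.2 (Real.exp_lt_one_iff.2 (by linarith))
  have hmix := integrable_mixture hpos hmeas hs (Real.exp_pos (-t)) hC
  rcases le_total (r ^ 4) (1 / 2) with hhalf | hhalf
  · have h := integral_mul_log_mixture_le hpos hmeas hone hMint hs (fun x => (hmix x).1) hF
    refine h.trans ?_
    have hlog := Real.one_sub_inv_le_log_of_pos hs
    rw [← hM, ha, hq] at *
    have hinv : (1 - r ^ 4)⁻¹ ≤ 1 + 2 * r ^ 4 := by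
      rw [inv_le_iff_one_le_mul₀ hs]
      nlinarith [pow_pos hr0 4]
    have h1 : -(d / 2) * Real.log (1 - r ^ 4) ≤ d / 2 * (2 * r ^ 4) := by nlinarith
    have h2 : r ^ 4 ≤ r := pow_le_of_le_one hr0.le hr1.le (by norm_num)
    have h3 : (L * d + M) * r ^ 4 ≤ (L * d + M) * r :=
      mul_le_mul_of_nonneg_left h2 (hd0.le.trans hlow)
    have h4 := mul_le_mul_of_nonneg_right hlow (pow_pos hr0 4).le
    have h5 : 0 ≤ L * d * r ^ 4 := by positivity
    nlinarith
  · have h := integral_mul_log_mixture_le_of_log_le hpos hmeas hone hMint hs (Real.exp_pos (-t))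
      hC hF
    refine h.trans ?_
    have hlog := Real.one_sub_inv_le_log_of_pos (Real.exp_pos (-2 * t))
    rw [Real.log_exp] at hlog ⊢
    rw [← hM, ha, hq] at *
    have hinv : (r ^ 4)⁻¹ - r ^ 4 ≤ 3 / 2 := by
      have : (r ^ 4)⁻¹ ≤ 2 := by
        rw [inv_le_comm₀ (by positivity) two_pos]
        linarith
      linarith
    have h1 : d * t ≤ d / 2 * ((r ^ 4)⁻¹ - 1) := by nlinarith
    have h2 := mul_le_mul_of_nonneg_left hinv hd0.le
    have h3 : 3 / 4 ≤ r := by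
      by_contra! hlt
      have := pow_lt_pow_left₀ hlt hr0.le (n := 4) (by norm_num)
      norm_num at this
      linarith
    have h4 : (L * d + M) * (3 / 4) ≤ (L * d + M) * r :=
      mul_le_mul_of_nonneg_left h3 (hd0.le.trans hlow)
    have h5 : r ^ 4 * M ≤ M := mul_le_of_le_one_left hM0 (pow_le_one₀ hr0.le hr1.le)
    nlinarith
end

section
/- Let d ≥ 1 and L, σ > 0 with L ≤ 1/(2σ²). Let f : ℝ^d → ℝ be continuously differentiable with L-Lipschitz gradient and e^{-f} integrable, let p = e^{-f}/∫ e^{-f} be the associated probability density, and let φ_{σ²}(x) = (2πσ²)^{-d/2} exp(−‖x‖²/(2σ²)) be the density of N(0, σ² I_d). Then for every x ∈ ℝ^d, ‖∇ log p(x) − ∇ log (p ∗ φ_{σ²})(x)‖ ≤ 6 L σ d^{1/2} + 2 L σ² ‖∇f(x)‖, where (p ∗ φ_{σ²})(x) = ∫ p(y) φ_{σ²}(x − y) dy is the convolution. -/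
open MeasureTheory Real

section SmoothedScore

variable {E : Type*} [NormedAddCommGroup E]

/-- The unnormalised posterior weight `e^{-f(y)} e^{-‖y-x‖²/(2v)}`. -/
noncomputable def posteriorWeight (f : E → ℝ) (v : ℝ) (x y : E) : ℝ :=
  Real.exp (-f y) * Real.exp (-‖y - x‖ ^ 2 / (2 * v))

lemma posteriorWeight_pos (f : E → ℝ) (v : ℝ) (x y : E) : 0 < posteriorWeight f v x y := by
  unfold posteriorWeight; positivity

/-- Quadratic growth is absorbed by a Gaussian. -/
lemma exp_neg_sq_div_mul_one_add_sq_le {v : ℝ} (hv : 0 < v) (r : ℝ) :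
    Real.exp (-r ^ 2 / (2 * v)) * (1 + r ^ 2) ≤ 1 + 2 * v := by
  set t := r ^ 2 / (2 * v) with ht
  have ht0 : 0 ≤ t := by positivity
  have hr : r ^ 2 = 2 * v * t := by rw [ht]; field_simp
  have e1 : -r ^ 2 / (2 * v) = -t := by rw [ht]; ring
  have e2 : Real.exp (-t) * Real.exp t = 1 := by rw [← Real.exp_add]; simp
  have e3 := Real.add_one_le_exp t
  have e4 := Real.exp_pos (-t)
  have e5 : Real.exp (-t) ≤ 1 := by simpa using ht0
  have e6 : Real.exp (-t) * t ≤ 1 := by nlinarith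
  rw [e1, hr]
  nlinarith

lemma le_one_add_sq (r : ℝ) : r ≤ 1 + r ^ 2 := by nlinarith [sq_nonneg (r - 1)]

variable [InnerProductSpace ℝ E]

/-- Derivative of the Gaussian factor in its centre. -/
lemma hasFDerivAt_posteriorWeight_center (f : E → ℝ) {v : ℝ} (hv : 0 < v) (x y : E) :
    HasFDerivAt (fun z => posteriorWeight f v z y)
      (posteriorWeight f v x y • innerSL ℝ (v⁻¹ • (y - x))) x := by
  have h1 : HasFDerivAt (fun z : E => y - z) (-ContinuousLinearMap.id ℝ E) x :=
    (hasFDerivAt_id x).const_sub y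
  have h2 := ((h1.norm_sq.neg.mul_const (2 * v)⁻¹).exp).const_mul (Real.exp (-f y))
  refine (h2.congr_fderiv ?_).congr_of_eventuallyEq (Filter.Eventually.of_forall fun z => ?_)
  · ext u
    simp only [posteriorWeight, Pi.neg_apply, smul_apply, neg_apply, ContinuousLinearMap.comp_apply, innerSL_apply_apply,
      ContinuousLinearMap.id_apply, smul_eq_mul, inner_neg_right, real_inner_smul_left,
      nsmul_eq_mul, div_eq_mul_inv]
    field_simp
    simp
  · simp [posteriorWeight, div_eq_mul_inv]

section

variable [CompleteSpace E]

/-- Derivative of the posterior weight in the integration variable. -/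
lemma hasFDerivAt_posteriorWeight {f : E → ℝ} (hf : Differentiable ℝ f) {v : ℝ} (hv : 0 < v)
    (x y : E) :
    HasFDerivAt (posteriorWeight f v x)
      (-posteriorWeight f v x y • innerSL ℝ (gradient f y + v⁻¹ • (y - x))) y := by
  have h1 : HasFDerivAt (fun z : E => z - x) (ContinuousLinearMap.id ℝ E) y :=
    (hasFDerivAt_id y).sub_const x
  have h0 : HasFDerivAt f (innerSL ℝ (gradient f y)) y := (hf y).hasGradientAt.hasFDerivAt
  have h2 := h0.neg.exp.mul (h1.norm_sq.neg.mul_const (2 * v)⁻¹).exp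
  refine (h2.congr_fderiv ?_).congr_of_eventuallyEq (Filter.Eventually.of_forall fun z => ?_)
  · ext u
    simp only [posteriorWeight, Pi.neg_apply, smul_apply, add_apply, neg_apply, ContinuousLinearMap.comp_apply, innerSL_apply_apply,
      ContinuousLinearMap.id_apply, smul_eq_mul, inner_add_left, real_inner_smul_left,
      nsmul_eq_mul, div_eq_mul_inv]
    field_simp
    push_cast
    ring
  · simp [posteriorWeight, div_eq_mul_inv]

lemma continuous_gradient {f : E → ℝ} (hf : ContDiff ℝ 1 f) : Continuous (gradient f) :=
  (InnerProductSpace.toDual ℝ E).symm.continuous.comp (hf.continuous_fderiv one_ne_zero)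

end

variable [FiniteDimensional ℝ E] [MeasurableSpace E] [BorelSpace E] {μ : Measure E}

/-- Functions of at most quadratic growth are integrable against the posterior weight. -/
lemma integrable_posteriorWeight_smul {F : Type*} [NormedAddCommGroup F] [NormedSpace ℝ F]
    {f : E → ℝ} {v : ℝ} (hv : 0 < v)
    (hint : Integrable (fun y => Real.exp (-f y)) μ) (x : E) {h : E → F} (hh : Continuous h)
    {C : ℝ} (hC : ∀ y, ‖h y‖ ≤ C * (1 + ‖y - x‖ ^ 2)) :
    Integrable (fun y => posteriorWeight f v x y • h y) μ := by
  have hC0 : 0 ≤ C := by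
    have := (norm_nonneg _).trans (hC x)
    simpa using this
  have := hint.smul_bdd (f := fun y => Real.exp (-‖y - x‖ ^ 2 / (2 * v)) • h y)
    (C * (1 + 2 * v)) (Continuous.aestronglyMeasurable (by fun_prop))
    (Filter.Eventually.of_forall fun y => ?_)
  · refine this.congr (Filter.Eventually.of_forall fun y => ?_)
    simp [posteriorWeight, mul_smul]
  · rw [norm_smul, Real.norm_eq_abs, Real.abs_exp]
    calc _ ≤ Real.exp (-‖y - x‖ ^ 2 / (2 * v)) * (C * (1 + ‖y - x‖ ^ 2)) := by
          gcongr; exact hC y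
      _ = C * (Real.exp (-‖y - x‖ ^ 2 / (2 * v)) * (1 + ‖y - x‖ ^ 2)) := by ring
      _ ≤ _ := by gcongr; exact exp_neg_sq_div_mul_one_add_sq_le hv _

lemma integrable_posteriorWeight {f : E → ℝ} {v : ℝ} (hv : 0 < v)
    (hint : Integrable (fun y => Real.exp (-f y)) μ) (x : E) :
    Integrable (posteriorWeight f v x) μ := by
  simpa using integrable_posteriorWeight_smul (C := 1) hv hint x (h := fun _ => (1 : ℝ))
    continuous_const (fun y => by simp)

lemma integral_posteriorWeight_pos {f : E → ℝ} {v : ℝ} (hv : 0 < v)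
    (hint : Integrable (fun y => Real.exp (-f y)) μ) [NeZero μ] (x : E) :
    0 < ∫ y, posteriorWeight f v x y ∂μ := by
  have hi := integrable_posteriorWeight hv hint x
  rw [integral_pos_iff_support_of_nonneg (fun y => (posteriorWeight_pos f v x y).le) hi,
    Function.support_eq_univ fun y => (posteriorWeight_pos f v x y).ne']
  exact NeZero.pos _

variable [CompleteSpace E]

/-- Differentiation under the integral sign for the Gaussian smoothing of `e^{-f}`. -/
lemma hasGradientAt_integral_posteriorWeight {f : E → ℝ} {v : ℝ} (hv : 0 < v)
    (hint : Integrable (fun y => Real.exp (-f y)) μ) (x : E) :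
    HasGradientAt (fun z => ∫ y, posteriorWeight f v z y ∂μ)
      (∫ y, posteriorWeight f v x y • v⁻¹ • (y - x) ∂μ) x := by
  have hi1 : Integrable (fun y => posteriorWeight f v x y • v⁻¹ • (y - x)) μ :=
    integrable_posteriorWeight_smul (C := v⁻¹) hv hint x (by fun_prop) (fun y => by
      rw [norm_smul, Real.norm_of_nonneg (by positivity)]
      gcongr
      exact le_one_add_sq _)
  have hi2 : Integrable
      (fun y => posteriorWeight f v x y • innerSL ℝ (v⁻¹ • (y - x))) μ :=
    integrable_posteriorWeight_smul (C := v⁻¹) hv hint x (by fun_prop) (fun y => by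
      rw [innerSL_apply_norm, norm_smul, Real.norm_of_nonneg (by positivity)]
      gcongr
      exact le_one_add_sq _)
  have key := hasFDerivAt_integral_of_dominated_of_fderiv_le (μ := μ) (x₀ := x) (s := Set.univ)
    (F := fun z y => posteriorWeight f v z y)
    (F' := fun z y => posteriorWeight f v z y • innerSL ℝ (v⁻¹ • (y - z)))
    (bound := fun y => Real.exp (-f y) * (v⁻¹ * (1 + 2 * v))) Filter.univ_mem
    (Filter.Eventually.of_forall fun z =>
      (integrable_posteriorWeight hv hint z).aestronglyMeasurable)
    (integrable_posteriorWeight hv hint x)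
    hi2.aestronglyMeasurable
    (Filter.Eventually.of_forall fun y z _ => ?_)
    (hint.mul_const _)
    (Filter.Eventually.of_forall fun y z _ => hasFDerivAt_posteriorWeight_center f hv z y)
  · rw [hasGradientAt_iff_hasFDerivAt]
    refine key.congr_fderiv (ContinuousLinearMap.ext fun u => ?_)
    rw [ContinuousLinearMap.integral_apply hi2, InnerProductSpace.toDual_apply_apply,
      real_inner_comm, ← integral_inner hi1]
    congr 1
    ext y
    simp only [smul_apply, innerSL_apply_apply, smul_eq_mul, real_inner_smul_right,
      real_inner_comm u]
  · rw [norm_smul, innerSL_apply_norm, norm_smul, Real.norm_of_nonneg (inv_nonneg.2 hv.le),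
      Real.norm_of_nonneg (posteriorWeight_pos f v z y).le, posteriorWeight]
    have h1 := exp_neg_sq_div_mul_one_add_sq_le hv ‖y - z‖
    calc _ = Real.exp (-f y) * (v⁻¹ * (Real.exp (-‖y - z‖ ^ 2 / (2 * v)) * ‖y - z‖)) := by ring
      _ ≤ Real.exp (-f y) *
          (v⁻¹ * (Real.exp (-‖y - z‖ ^ 2 / (2 * v)) * (1 + ‖y - z‖ ^ 2))) := by
          gcongr; exact le_one_add_sq _
      _ ≤ _ := by gcongr

variable [μ.IsAddHaarMeasure]

/-- Integration by parts against the posterior weight, for test functions of linear growth. -/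
lemma integral_posteriorWeight_mul_inner {f : E → ℝ} (hf : ContDiff ℝ 1 f) {L v : ℝ} (hL : 0 ≤ L)
    (hv : 0 < v) (hlip : ∀ x y, ‖gradient f x - gradient f y‖ ≤ L * ‖x - y‖)
    (hint : Integrable (fun y => Real.exp (-f y)) μ) (x u : E) (a : E →L[ℝ] ℝ) (b : ℝ) :
    ∫ y, posteriorWeight f v x y * ((a (y - x) + b) * inner ℝ (gradient f y + v⁻¹ • (y - x)) u) ∂μ
      = a u * ∫ y, posteriorWeight f v x y ∂μ := by
  have hg := continuous_gradient hf
  have ha : ∀ y, HasFDerivAt (fun y => a (y - x) + b) a y := fun y =>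
    (a.hasFDerivAt.comp y ((hasFDerivAt_id y).sub_const x)).add_const b
  have hw := fun y => hasFDerivAt_posteriorWeight (hf.differentiable one_ne_zero) hv x y
  have hab : ∀ y, ‖a (y - x) + b‖ ≤ (‖a‖ + |b|) * (1 + ‖y - x‖) := fun y => by
    have h1 := norm_add_le (a (y - x)) b
    have h2 := a.le_opNorm (y - x)
    rw [Real.norm_eq_abs b] at h1
    nlinarith [norm_nonneg a, abs_nonneg b, norm_nonneg (y - x),
      mul_nonneg (abs_nonneg b) (norm_nonneg (y - x))]
  have hgrad : ∀ y, ‖gradient f y + v⁻¹ • (y - x)‖ ≤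
      (‖gradient f x‖ + L + v⁻¹) * (1 + ‖y - x‖) := fun y => by
    have h1 := norm_add_le (gradient f y) (v⁻¹ • (y - x))
    have h2 := norm_add_le (gradient f x) (gradient f y - gradient f x)
    rw [add_sub_cancel] at h2
    rw [norm_smul, Real.norm_of_nonneg (inv_nonneg.2 hv.le)] at h1
    have h3 := hlip y x
    have h4 : 0 ≤ v⁻¹ := by positivity
    nlinarith [norm_nonneg (gradient f x), norm_nonneg (y - x),
      mul_nonneg (norm_nonneg (gradient f x)) (norm_nonneg (y - x))]
  have hsq : ∀ y, (1 + ‖y - x‖) * (1 + ‖y - x‖) ≤ 2 * (1 + ‖y - x‖ ^ 2) := fun y => by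
    nlinarith [sq_nonneg (‖y - x‖ - 1)]
  have hi0 : Integrable (fun y => posteriorWeight f v x y • a u) μ :=
    integrable_posteriorWeight_smul hv hint x continuous_const (C := ‖a u‖)
      (fun y => by nlinarith [norm_nonneg (a u), mul_nonneg (norm_nonneg (a u)) (sq_nonneg ‖y - x‖)])
  have hi1 : Integrable (fun y => posteriorWeight f v x y • (a (y - x) + b)) μ :=
    integrable_posteriorWeight_smul hv hint x (by fun_prop) (C := (‖a‖ + |b|) * 2)
      (fun y => (hab y).trans (by
        rw [mul_assoc]
        gcongr
        nlinarith [hsq y, norm_nonneg (y - x), sq_nonneg ‖y - x‖]))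
  have hi2 : Integrable (fun y => posteriorWeight f v x y •
      ((a (y - x) + b) * inner ℝ (gradient f y + v⁻¹ • (y - x)) u)) μ :=
    integrable_posteriorWeight_smul hv hint x (by fun_prop)
      (C := (‖a‖ + |b|) * (‖gradient f x‖ + L + v⁻¹) * ‖u‖ * 2) (fun y => by
        rw [norm_mul]
        calc _ ≤ ((‖a‖ + |b|) * (1 + ‖y - x‖)) *
              (((‖gradient f x‖ + L + v⁻¹) * (1 + ‖y - x‖)) * ‖u‖) := by
              gcongr
              · exact hab y
              · exact (norm_inner_le_norm _ _).trans (by gcongr; exact hgrad y)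
          _ = (‖a‖ + |b|) * (‖gradient f x‖ + L + v⁻¹) * ‖u‖ *
              ((1 + ‖y - x‖) * (1 + ‖y - x‖)) := by ring
          _ ≤ (‖a‖ + |b|) * (‖gradient f x‖ + L + v⁻¹) * ‖u‖ * (2 * (1 + ‖y - x‖ ^ 2)) := by
              exact mul_le_mul_of_nonneg_left (hsq y) (by positivity)
          _ = _ := by ring)
  have key := integral_mul_fderiv_eq_neg_fderiv_mul_of_integrable (μ := μ) (v := u)
    (f := fun y => a (y - x) + b) (g := posteriorWeight f v x)
    (by simpa only [(ha _).fderiv, smul_eq_mul, mul_comm] using hi0)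
    (by
      refine hi2.neg.congr (Filter.Eventually.of_forall fun y => ?_)
      simp only [(hw y).fderiv, smul_apply, innerSL_apply_apply, smul_eq_mul, Pi.neg_apply]
      ring)
    (by simpa only [smul_eq_mul, mul_comm] using hi1)
    (fun y _ => (ha y).differentiableAt) (fun y _ => (hw y).differentiableAt)
  simp only [(ha _).fderiv, integral_const_mul] at key
  rw [← neg_inj, ← key, ← integral_neg]
  congr 1
  ext y
  simp only [(hw y).fderiv, smul_apply, innerSL_apply_apply, smul_eq_mul]
  ring

/-- First absolute moment bound for the posterior weight around `x`. -/
lemma integral_posteriorWeight_mul_norm_le {f : E → ℝ} (hf : ContDiff ℝ 1 f) {L v : ℝ}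
    (hL : 0 ≤ L) (hv : 0 < v) (hLv : L ≤ 1 / (2 * v))
    (hlip : ∀ x y, ‖gradient f x - gradient f y‖ ≤ L * ‖x - y‖)
    (hint : Integrable (fun y => Real.exp (-f y)) μ) (x : E) :
    ∫ y, posteriorWeight f v x y * ‖y - x‖ ∂μ ≤
      (√(2 * v * Module.finrank ℝ E) + 2 * v * ‖gradient f x‖) *
        ∫ y, posteriorWeight f v x y ∂μ := by
  have hg := continuous_gradient hf
  set n := Module.finrank ℝ E
  set g := ‖gradient f x‖ with hgdef
  set Z := ∫ y, posteriorWeight f v x y ∂μ with hZ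
  set R := ∫ y, posteriorWeight f v x y * ‖y - x‖ ∂μ with hR
  have hZ0 : 0 < Z := integral_posteriorWeight_pos hv hint x
  have hr : ∀ y, ‖y - x‖ ≤ 1 + ‖y - x‖ ^ 2 := fun y => le_one_add_sq _
  have hi0 := integrable_posteriorWeight hv hint x
  have hi1 : Integrable (fun y => posteriorWeight f v x y * ‖y - x‖) μ :=
    integrable_posteriorWeight_smul (C := 1) hv hint x (by fun_prop)
      (fun y => by simpa using hr y)
  have hi2 : Integrable (fun y => posteriorWeight f v x y * ‖y - x‖ ^ 2) μ :=
    integrable_posteriorWeight_smul (C := 1) hv hint x (by fun_prop) (fun y => by simp)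
  have hgr : ∀ y, ‖gradient f y + v⁻¹ • (y - x)‖ ≤ g + (L + v⁻¹) * ‖y - x‖ := fun y => by
    have h1 := norm_add_le (gradient f y) (v⁻¹ • (y - x))
    have h2 := norm_add_le (gradient f x) (gradient f y - gradient f x)
    rw [add_sub_cancel] at h2
    rw [norm_smul, Real.norm_of_nonneg (inv_nonneg.2 hv.le)] at h1
    have h3 := hlip y x
    linarith
  have hg0 : 0 ≤ g := norm_nonneg _
  have hv0 : 0 ≤ v⁻¹ := by positivity
  let e := stdOrthonormalBasis ℝ E
  have hsum : ∫ y, posteriorWeight f v x y *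
      inner ℝ (gradient f y + v⁻¹ • (y - x)) (y - x) ∂μ = n * Z := by
    have hpart := fun i => integral_posteriorWeight_mul_inner hf hL hv hlip hint x (e i)
      (innerSL ℝ (e i)) 0
    have hone : ∀ i, innerSL ℝ (e i) (e i) = 1 := fun i => by simp
    simp only [hone, one_mul] at hpart
    have hii : ∀ i, Integrable (fun y => posteriorWeight f v x y * ((innerSL ℝ (e i) (y - x) + 0) *
        inner ℝ (gradient f y + v⁻¹ • (y - x)) (e i))) μ := fun i =>
      Integrable.of_integral_ne_zero (by rw [hpart]; exact hZ0.ne')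
    have := integral_finsetSum (μ := μ) Finset.univ (fun i _ => hii i)
    simp only [hpart, Finset.sum_const, Finset.card_univ, Fintype.card_fin, nsmul_eq_mul] at this
    rw [hZ, ← this]
    congr 1
    ext y
    rw [← Finset.mul_sum, ← e.sum_inner_mul_inner]
    congr 1
    refine Finset.sum_congr rfl fun i _ => ?_
    simp [mul_comm]
  have hi3 : Integrable (fun y => posteriorWeight f v x y *
      inner ℝ (gradient f y + v⁻¹ • (y - x)) (y - x)) μ :=
    integrable_posteriorWeight_smul (C := g + (L + v⁻¹)) hv hint x (by fun_prop) (fun y => by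
      refine (norm_inner_le_norm _ _).trans ?_
      calc _ ≤ (g + (L + v⁻¹) * ‖y - x‖) * ‖y - x‖ := by gcongr; exact hgr y
        _ = g * ‖y - x‖ + (L + v⁻¹) * ‖y - x‖ ^ 2 := by ring
        _ ≤ g * (1 + ‖y - x‖ ^ 2) + (L + v⁻¹) * (1 + ‖y - x‖ ^ 2) := by
            gcongr
            · exact hr y
            · linarith
        _ = _ := by ring)
  set s := R / Z with hs
  have hRs : R = s * Z := by rw [hs]; field_simp
  have hpt : ∀ y, posteriorWeight f v x y * ((2 * v)⁻¹ * (2 * s * ‖y - x‖ - s ^ 2) - g * ‖y - x‖) ≤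
      posteriorWeight f v x y * inner ℝ (gradient f y + v⁻¹ • (y - x)) (y - x) := fun y => by
    refine mul_le_mul_of_nonneg_left ?_ (posteriorWeight_pos f v x y).le
    have h1 : inner ℝ (gradient f y + v⁻¹ • (y - x)) (y - x) =
        inner ℝ (gradient f x) (y - x) + inner ℝ (gradient f y - gradient f x) (y - x) +
          v⁻¹ * ‖y - x‖ ^ 2 := by
      rw [inner_add_left, inner_sub_left, real_inner_smul_left, real_inner_self_eq_norm_sq]
      ring
    have h2 := neg_le_of_abs_le (abs_real_inner_le_norm (gradient f x) (y - x))
    have h3 := neg_le_of_abs_le (abs_real_inner_le_norm (gradient f y - gradient f x) (y - x))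
    have h4 : ‖gradient f y - gradient f x‖ * ‖y - x‖ ≤ (2 * v)⁻¹ * ‖y - x‖ ^ 2 := by
      rw [pow_two, ← mul_assoc]
      gcongr
      refine (hlip y x).trans ?_
      gcongr
      simpa using hLv
    have h5 : v⁻¹ = (2 * v)⁻¹ + (2 * v)⁻¹ := by field_simp; norm_num
    have h6 : 0 ≤ (2 * v)⁻¹ * (‖y - x‖ - s) ^ 2 := by positivity
    rw [h1, h5]
    linarith
  have hi4 : Integrable (fun y => posteriorWeight f v x y *
      ((2 * v)⁻¹ * (2 * s * ‖y - x‖ - s ^ 2) - g * ‖y - x‖)) μ := by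
    refine ((hi1.const_mul ((2 * v)⁻¹ * (2 * s) - g)).sub
      (hi0.const_mul ((2 * v)⁻¹ * s ^ 2))).congr (Filter.Eventually.of_forall fun y => ?_)
    simp only [Pi.sub_apply]
    ring
  have hle := integral_mono hi4 hi3 hpt
  have hcalc : ∫ y, posteriorWeight f v x y *
      ((2 * v)⁻¹ * (2 * s * ‖y - x‖ - s ^ 2) - g * ‖y - x‖) ∂μ =
      ((2 * v)⁻¹ * (2 * s) - g) * R - (2 * v)⁻¹ * s ^ 2 * Z := by
    rw [hR, hZ, ← integral_const_mul, ← integral_const_mul,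
      ← integral_sub (hi1.const_mul _) (hi0.const_mul _)]
    congr 1
    ext y
    ring
  rw [hcalc, hsum, hRs] at hle
  have hquad : (2 * v)⁻¹ * s ^ 2 - g * s ≤ n := by
    refine le_of_mul_le_mul_right ?_ hZ0
    linarith
  have hquad' : s ^ 2 - 2 * v * g * s ≤ 2 * v * n := by
    have := mul_le_mul_of_nonneg_left hquad (show 0 ≤ 2 * v by positivity)
    have h7 : 2 * v * ((2 * v)⁻¹ * s ^ 2 - g * s) = s ^ 2 - 2 * v * g * s := by field_simp
    linarith
  rw [hRs]
  refine mul_le_mul_of_nonneg_right ?_ hZ0.le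
  by_contra! hlt
  have hq0 := Real.sqrt_nonneg (2 * v * n)
  have hqq := Real.sq_sqrt (show 0 ≤ 2 * v * (n : ℝ) by positivity)
  have hvg : 0 ≤ 2 * v * g := by positivity
  nlinarith [mul_pos (show 0 < s by linarith) (sub_pos.2 hlt), mul_nonneg hq0 hvg]

/-- Bound on the difference between the score `-∇f` and the score of its Gaussian smoothing. -/
lemma norm_gradient_add_integral_posteriorWeight_le {f : E → ℝ} (hf : ContDiff ℝ 1 f) {L v : ℝ}
    (hL : 0 ≤ L) (hv : 0 < v) (hLv : L ≤ 1 / (2 * v))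
    (hlip : ∀ x y, ‖gradient f x - gradient f y‖ ≤ L * ‖x - y‖)
    (hint : Integrable (fun y => Real.exp (-f y)) μ) (x : E) :
    ‖gradient f x + (∫ y, posteriorWeight f v x y ∂μ)⁻¹ •
        ∫ y, posteriorWeight f v x y • v⁻¹ • (y - x) ∂μ‖ ≤
      L * (√(2 * v * Module.finrank ℝ E) + 2 * v * ‖gradient f x‖) := by
  have hg := continuous_gradient hf
  have hZ0 : 0 < ∫ y, posteriorWeight f v x y ∂μ := integral_posteriorWeight_pos hv hint x
  have hmom := integral_posteriorWeight_mul_norm_le hf hL hv hLv hlip hint x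
  have hr : ∀ y, ‖y - x‖ ≤ 1 + ‖y - x‖ ^ 2 := fun y => le_one_add_sq _
  have hi1 : Integrable (fun y => posteriorWeight f v x y • v⁻¹ • (y - x)) μ :=
    integrable_posteriorWeight_smul (C := v⁻¹) hv hint x (by fun_prop) (fun y => by
      rw [norm_smul, Real.norm_of_nonneg (by positivity)]
      gcongr
      exact hr y)
  have hi2 : Integrable (fun y => posteriorWeight f v x y • gradient f x) μ :=
    integrable_posteriorWeight_smul (C := ‖gradient f x‖) hv hint x (by fun_prop) (fun y => by
      nlinarith [norm_nonneg (gradient f x),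
        mul_nonneg (norm_nonneg (gradient f x)) (sq_nonneg ‖y - x‖)])
  have hi3 : Integrable (fun y => posteriorWeight f v x y • (gradient f y - gradient f x)) μ :=
    integrable_posteriorWeight_smul (C := L) hv hint x (by fun_prop) (fun y =>
      (hlip y x).trans (by gcongr; exact hr y))
  have hi4 : Integrable (fun y => posteriorWeight f v x y • (gradient f y + v⁻¹ • (y - x))) μ :=
    ((hi1.add hi2).add hi3).congr (Filter.Eventually.of_forall fun y => by
      simp only [Pi.add_apply, ← smul_add]
      congr 1
      abel)
  have hzero : ∫ y, posteriorWeight f v x y • (gradient f y + v⁻¹ • (y - x)) ∂μ = 0 := by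
    refine ext_inner_left ℝ fun u => ?_
    rw [← integral_inner hi4, inner_zero_right]
    have := integral_posteriorWeight_mul_inner hf hL hv hlip hint x u 0 1
    simp only [zero_apply, zero_add, one_mul, zero_mul] at this
    rw [← this]
    congr 1
    ext y
    rw [real_inner_smul_right, real_inner_comm]
  have hsplit : ∫ y, posteriorWeight f v x y • (gradient f y - gradient f x) ∂μ =
      -((∫ y, posteriorWeight f v x y ∂μ) • gradient f x +
        ∫ y, posteriorWeight f v x y • v⁻¹ • (y - x) ∂μ) := by
    rw [← integral_smul_const, ← integral_add hi2 hi1, ← zero_sub, ← hzero]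
    refine Eq.trans ?_ (integral_sub hi4 (hi2.add hi1))
    congr 1
    ext y
    simp only [← smul_add, ← smul_sub]
    congr 1
    abel
  have heq : gradient f x + (∫ y, posteriorWeight f v x y ∂μ)⁻¹ •
        ∫ y, posteriorWeight f v x y • v⁻¹ • (y - x) ∂μ =
      -((∫ y, posteriorWeight f v x y ∂μ)⁻¹ •
        ∫ y, posteriorWeight f v x y • (gradient f y - gradient f x) ∂μ) := by
    rw [hsplit, smul_neg, neg_neg, smul_add, inv_smul_smul₀ hZ0.ne']
  rw [heq, norm_neg, norm_smul, Real.norm_of_nonneg (inv_nonneg.2 hZ0.le), inv_mul_le_iff₀ hZ0]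
  calc ‖∫ y, posteriorWeight f v x y • (gradient f y - gradient f x) ∂μ‖
      ≤ ∫ y, ‖posteriorWeight f v x y • (gradient f y - gradient f x)‖ ∂μ :=
        norm_integral_le_integral_norm _
    _ ≤ ∫ y, L * (posteriorWeight f v x y * ‖y - x‖) ∂μ := by
        refine integral_mono hi3.norm (Integrable.const_mul ?_ L) fun y => ?_
        · exact integrable_posteriorWeight_smul (C := 1) hv hint x (by fun_prop)
            (fun y => by simpa using hr y)
        · have hp := posteriorWeight_pos f v x y
          simp only [norm_smul, Real.norm_of_nonneg hp.le]
          nlinarith [mul_le_mul_of_nonneg_left (hlip y x) hp.le]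
    _ ≤ _ := by
        rw [integral_const_mul]
        nlinarith [mul_le_mul_of_nonneg_left hmom hL]

end SmoothedScore

/-- For `L ≤ 1/(2σ²)`, `f` with `L`-Lipschitz gradient, `p = e^{-f}/∫ e^{-f}`,
and `φ_{σ²}` the centered Gaussian density with covariance `σ² I_d`, the scores of `p` and of
the Gaussian smoothing `p ∗ φ_{σ²}` satisfy
`‖∇ log p(x) − ∇ log (p ∗ φ_{σ²})(x)‖ ≤ 6Lσ√d + 2Lσ²‖∇f(x)‖` for all `x`. -/
theorem stmt_3 {d : ℕ} (hd : 1 ≤ d) (L σ : ℝ) (hL : 0 < L) (hσ : 0 < σ)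
    (hLσ : L ≤ 1 / (2 * σ ^ 2))
    (f : EuclideanSpace ℝ (Fin d) → ℝ)
    (hf : ContDiff ℝ 1 f)
    (hlip : ∀ x y, ‖gradient f x - gradient f y‖ ≤ L * ‖x - y‖)
    (hint : Integrable (fun x => Real.exp (-f x)))
    (p : EuclideanSpace ℝ (Fin d) → ℝ)
    (hp : p = fun x => Real.exp (-f x) / ∫ y, Real.exp (-f y))
    (φ : EuclideanSpace ℝ (Fin d) → ℝ)
    (hφ : φ = fun x => (2 * π * σ ^ 2) ^ (-(d : ℝ) / 2) * Real.exp (-‖x‖ ^ 2 / (2 * σ ^ 2)))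
    (pconv : EuclideanSpace ℝ (Fin d) → ℝ)
    (hpconv : pconv = fun x => ∫ y, p y * φ (x - y)) :
    ∀ x, ‖gradient (fun z => Real.log (p z)) x - gradient (fun z => Real.log (pconv z)) x‖
      ≤ 6 * L * σ * Real.sqrt d + 2 * L * σ ^ 2 * ‖gradient f x‖ := by
  intro x
  have hv : 0 < σ ^ 2 := by positivity
  have hI : 0 < ∫ y, Real.exp (-f y) := integral_exp_pos hint
  have hlogp : gradient (fun z => Real.log (p z)) x = -gradient f x := by
    have h1 : (fun z => Real.log (p z)) = fun z => -f z - Real.log (∫ y, Real.exp (-f y)) := by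
      ext z
      rw [hp, Real.log_div (Real.exp_pos _).ne' hI.ne', Real.log_exp]
    have h2 := ((hf.differentiable one_ne_zero x).hasGradientAt.hasFDerivAt.neg).sub_const
      (Real.log (∫ y, Real.exp (-f y)))
    rw [h1]
    refine HasGradientAt.gradient ?_
    rw [hasGradientAt_iff_hasFDerivAt, map_neg]
    exact h2
  set Z := ∫ y, posteriorWeight f (σ ^ 2) x y with hZ
  set M := ∫ y, posteriorWeight f (σ ^ 2) x y • (σ ^ 2)⁻¹ • (y - x) with hM
  have hZ0 : 0 < Z := integral_posteriorWeight_pos hv hint x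
  have hlogc : gradient (fun z => Real.log (pconv z)) x = Z⁻¹ • M := by
    set c := (∫ y, Real.exp (-f y))⁻¹ * (2 * π * σ ^ 2) ^ (-(d : ℝ) / 2)
    have hc : 0 < c := by positivity
    have h1 : (fun z => Real.log (pconv z)) =
        fun z => Real.log c + Real.log (∫ y, posteriorWeight f (σ ^ 2) z y) := by
      ext z
      rw [← Real.log_mul hc.ne' (integral_posteriorWeight_pos hv hint z).ne', hpconv,
        ← integral_const_mul]
      congr 1
      refine integral_congr_ae (Filter.Eventually.of_forall fun y => ?_)
      beta_reduce
      rw [hp, hφ, posteriorWeight, norm_sub_rev y z]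
      simp only [c]
      ring
    have h2 := ((hasGradientAt_integral_posteriorWeight hv hint x).hasFDerivAt.log
      hZ0.ne').const_add (Real.log c)
    rw [h1]
    refine HasGradientAt.gradient ?_
    rw [hasGradientAt_iff_hasFDerivAt, map_smulₛₗ]
    exact h2
  have hmain := norm_gradient_add_integral_posteriorWeight_le hf hL.le hv hLσ hlip hint x
  rw [← hZ, ← hM, finrank_euclideanSpace, Fintype.card_fin] at hmain
  rw [hlogp, hlogc, ← neg_add', norm_neg]
  refine hmain.trans ?_
  have hsqrt : √(2 * σ ^ 2 * d) ≤ 6 * (σ * √d) := by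
    rw [Real.sqrt_le_left (by positivity), mul_pow, mul_pow, Real.sq_sqrt (Nat.cast_nonneg d)]
    have : 0 ≤ σ ^ 2 * (d : ℝ) := by positivity
    linarith
  nlinarith [mul_le_mul_of_nonneg_left hsqrt hL.le]
end
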